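/- Let A be a finite Taylor algebra and ρ ∈ Con(A) meet-irreducible with unique upper cover ρ⁺. Then Opt(ρ) = (ρ : ρ⁺); consequently ρ⁺/ρ is abelian if and only if Opt(ρ) > ρ. -/

import Mathlib

namespace Zhuk

/-- A signature: a type of operation symbols with arities. -/
structure Signature where
  ops : Type
  arity : ops → ℕ

/-- An algebra structure of signature `S` on carrier `A`. -/
class SAlg (S : Signature) (A : Type) where
  interp : (o : S.ops) → (Fin (S.arity o) → A) → A

variable {S : Signature}

/-- Componentwise algebra structure on a product. -/
instance prodSAlg {A B : Type} [SAlg S A] [SAlg S B] : SAlg S (A × B) :=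
  ⟨fun o x => (SAlg.interp o fun i => (x i).1, SAlg.interp o fun i => (x i).2)⟩

/-- A subset closed under all the operations. -/
def IsSubuniverse (S : Signature) {A : Type} [SAlg S A] (R : Set A) : Prop :=
  ∀ (o : S.ops) (x : Fin (S.arity o) → A), (∀ i, x i ∈ R) → SAlg.interp o x ∈ R

/-- The algebra structure on (the subtype of) a subuniverse. -/
def subAlg {A : Type} [SAlg S A] (R : Set A) (h : IsSubuniverse S R) : SAlg S ↥R :=
  ⟨fun o x => ⟨SAlg.interp o fun i => (x i).1, h o _ fun i => (x i).2⟩⟩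

/-- Terms of signature `S` in `n` variables. -/
inductive STerm (S : Signature) (n : ℕ) : Type
  | var : Fin n → STerm S n
  | app (o : S.ops) : (Fin (S.arity o) → STerm S n) → STerm S n

/-- Evaluation of a term in an algebra. -/
def STerm.eval {A : Type} [SAlg S A] {n : ℕ} : STerm S n → (Fin n → A) → A
  | .var i, v => v i
  | .app o ts, v => SAlg.interp o fun i => (ts i).eval v

/-- The diagonal (smallest) congruence `0_A`. -/
def diag (A : Type) : Set (A × A) := {p | p.1 = p.2}

/-- Relational composition. -/
def rcomp {A B C : Type} (R : Set (A × B)) (T : Set (B × C)) : Set (A × C) :=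
  {p | ∃ b, (p.1, b) ∈ R ∧ (b, p.2) ∈ T}

/-- Relational inverse. -/
def rinv {A B : Type} (R : Set (A × B)) : Set (B × A) := {p | (p.2, p.1) ∈ R}

/-- Transitive closure of a binary relation (as a set of pairs). -/
def transCl {A : Type} (R : Set (A × A)) : Set (A × A) :=
  {p | Relation.TransGen (fun a b => (a, b) ∈ R) p.1 p.2}

/-- `R` is stable under (saturated with respect to) `ρ`:  `R = ρ ∘ R ∘ ρ`. -/
def Saturated {A : Type} (ρ R : Set (A × A)) : Prop := rcomp ρ (rcomp R ρ) = R

/-- A congruence: a subuniverse of `A²` which is an equivalence relation. -/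
def IsCongruence (S : Signature) {A : Type} [SAlg S A] (θ : Set (A × A)) : Prop :=
  IsSubuniverse S θ ∧ Equivalence fun a b => (a, b) ∈ θ

/-- `ρ ∈ Con*(A)`: a congruence different from the full congruence `1_A`. -/
def ConStar (S : Signature) {A : Type} [SAlg S A] (ρ : Set (A × A)) : Prop :=
  IsCongruence S ρ ∧ ρ ≠ Set.univ

/-- The ternary centralizer relation `C(φ, θ; δ)`, via the term condition. -/
def Centralizes (S : Signature) {A : Type} [SAlg S A] (φ θ δ : Set (A × A)) : Prop :=
  ∀ (n : ℕ) (t : STerm S (n + 1)) (a b : A) (c d : Fin n → A),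
    (a, b) ∈ φ → (∀ i, (c i, d i) ∈ θ) →
    (t.eval (Fin.cons a c), t.eval (Fin.cons a d)) ∈ δ →
    (t.eval (Fin.cons b c), t.eval (Fin.cons b d)) ∈ δ

/-- The centralizer `(δ : θ)`: the largest congruence `φ` with `C(φ, θ; δ)`. -/
def centralizer (S : Signature) {A : Type} [SAlg S A] (δ θ : Set (A × A)) : Set (A × A) :=
  ⋃₀ {φ | IsCongruence S φ ∧ Centralizes S φ θ δ}

/-- A congruence of the subalgebra `A(θ) ≤ A²`, viewed ambiently as a subset of
`(A×A) × (A×A)` whose field is `θ`. -/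
def IsConOn (S : Signature) {A : Type} [SAlg S A] (θ : Set (A × A))
    (Δ : Set ((A × A) × (A × A))) : Prop :=
  Δ ⊆ θ ×ˢ θ ∧ IsSubuniverse S Δ ∧ (∀ p ∈ θ, (p, p) ∈ Δ) ∧
    (∀ p q, (p, q) ∈ Δ → (q, p) ∈ Δ) ∧ (∀ p q r, (p, q) ∈ Δ → (q, r) ∈ Δ → (p, r) ∈ Δ)

/-- `Δ_{θ,α}`: the congruence of `A(θ)` generated by `{((a,a),(b,b)) : (a,b) ∈ α}`. -/
def DeltaCon (S : Signature) {A : Type} [SAlg S A] (θ α : Set (A × A)) :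
    Set ((A × A) × (A × A)) :=
  ⋂₀ {Δ | IsConOn S θ Δ ∧ ∀ a b : A, (a, b) ∈ α → ((a, a), (b, b)) ∈ Δ}

/-- Projection of a quaternary relation to its first two coordinates. -/
def pr12 {A B : Type} (T : Set (A × A × B × B)) : Set (A × A) :=
  {p | ∃ b₁ b₂, (p.1, p.2, b₁, b₂) ∈ T}

/-- Projection of a quaternary relation to its last two coordinates. -/
def pr34 {A B : Type} (T : Set (A × A × B × B)) : Set (B × B) :=
  {q | ∃ a₁ a₂, (a₁, a₂, q.1, q.2) ∈ T}

/-- The trace of a quaternary relation. -/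
def btr {A B : Type} (T : Set (A × A × B × B)) : Set (A × B) :=
  {p | (p.1, p.1, p.2, p.2) ∈ T}

/-- Zhuk's bridges: Definition 4.3 (B0*), (B1*), (B2*). -/
def IsBridge (S : Signature) {A B : Type} [SAlg S A] [SAlg S B]
    (ρ : Set (A × A)) (σ : Set (B × B)) (T : Set (A × A × B × B)) : Prop :=
  IsSubuniverse S T ∧
  (∀ a₁ a₂ b₁ b₂ a₁' a₂', (a₁, a₂, b₁, b₂) ∈ T → (a₁, a₁') ∈ ρ → (a₂, a₂') ∈ ρ →
    (a₁', a₂', b₁, b₂) ∈ T) ∧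
  (∀ a₁ a₂ b₁ b₂ b₁' b₂', (a₁, a₂, b₁, b₂) ∈ T → (b₁, b₁') ∈ σ → (b₂, b₂') ∈ σ →
    (a₁, a₂, b₁', b₂') ∈ T) ∧
  ρ ⊂ pr12 T ∧ σ ⊂ pr34 T ∧
  (∀ a₁ a₂ b₁ b₂, (a₁, a₂, b₁, b₂) ∈ T → ((a₁, a₂) ∈ ρ ↔ (b₁, b₂) ∈ σ))

/-- A bridge from `(A,ρ,L)` to `(B,σ,R)`: a bridge with prescribed anchors. -/
def IsBridgeLR (S : Signature) {A B : Type} [SAlg S A] [SAlg S B]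
    (ρ : Set (A × A)) (σ : Set (B × B)) (L : Set (A × A)) (R : Set (B × B))
    (T : Set (A × A × B × B)) : Prop :=
  IsBridge S ρ σ T ∧ pr12 T = L ∧ pr34 T = R

/-- A reflexive bridge (case `B = A`): `0_A ⊆ tr(T)`. -/
def ReflBridge {A : Type} (T : Set (A × A × A × A)) : Prop :=
  ∀ a : A, (a, a) ∈ btr T

/-- `Cov(ρ)`: the inclusion-minimal ρ-saturated subuniverses of `A²` properly containing ρ. -/
def Cov (S : Signature) {A : Type} [SAlg S A] (ρ : Set (A × A)) : Set (Set (A × A)) :=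
  {L | IsSubuniverse S L ∧ Saturated ρ L ∧ ρ ⊂ L ∧
    ∀ L', IsSubuniverse S L' → Saturated ρ L' → ρ ⊂ L' → L' ⊆ L → L' = L}

/-- `ref.tr(ρ,L)`: traces of reflexive bridges from `(A,ρ,L)` to itself. -/
def refTr (S : Signature) {A : Type} [SAlg S A] (ρ L : Set (A × A)) : Set (Set (A × A)) :=
  {γ | ∃ T : Set (A × A × A × A), IsBridgeLR S ρ ρ L L T ∧ ReflBridge T ∧ btr T = γ}

/-- `γ = Opt(ρ,L)`: `γ` is the (unique) inclusion-maximal member of `ref.tr(ρ,L)`. -/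
def IsOptOf (S : Signature) {A : Type} [SAlg S A] (ρ L γ : Set (A × A)) : Prop :=
  γ ∈ refTr S ρ L ∧ ∀ δ ∈ refTr S ρ L, γ ⊆ δ → δ = γ

/-- `ρ` is meet-irreducible with unique upper cover `ρplus`. -/
def MeetIrredWith (S : Signature) {A : Type} [SAlg S A] (ρ ρplus : Set (A × A)) : Prop :=
  IsCongruence S ρ ∧ ρ ≠ Set.univ ∧ IsCongruence S ρplus ∧ ρ ⊂ ρplus ∧
    ∀ θ, IsCongruence S θ → ρ ⊂ θ → ρplus ⊆ θ

/-- `Cov⁺(ρ) = {τ ∈ Cov(ρ) : τ ⊆ ρ⁺}`. -/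
def CovPlus (S : Signature) {A : Type} [SAlg S A] (ρ ρplus : Set (A × A)) :
    Set (Set (A × A)) :=
  {τ | τ ∈ Cov S ρ ∧ τ ⊆ ρplus}

/-- A good bridge between meet-irreducible congruences with upper covers `ρplus`, `σplus`. -/
def GoodBridge (S : Signature) {A B : Type} [SAlg S A] [SAlg S B]
    (ρ ρplus : Set (A × A)) (σ σplus : Set (B × B)) (T : Set (A × A × B × B)) : Prop :=
  IsBridge S ρ σ T ∧
    ∃ τ ∈ CovPlus S ρ ρplus, ∃ τ' ∈ CovPlus S σ σplus, ∃ T' ⊆ T,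
      IsBridgeLR S ρ σ τ τ' T' ∧ btr T' = btr T

/-- `t` (with Taylor-identity data `u v`) is idempotent on `A` and satisfies the
corresponding identities on `A`. -/
def TaylorOn (S : Signature) (A : Type) [SAlg S A] {n : ℕ} (t : STerm S n)
    (u v : Fin n → Fin n → Fin 2) : Prop :=
  (∀ a : A, t.eval (fun _ => a) = a) ∧
    ∀ (i : Fin n) (x y : A),
      t.eval (fun j => if u i j = 0 then x else y) =
        t.eval (fun j => if v i j = 0 then x else y)

/-- `A` is a Taylor algebra. -/
def IsTaylorAlg (S : Signature) (A : Type) [SAlg S A] : Prop :=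
  ∃ (n : ℕ) (t : STerm S n) (u v : Fin n → Fin n → Fin 2),
    1 < n ∧ (∀ i, u i i ≠ v i i) ∧ TaylorOn S A t u v

/-- `A` and `B` lie in a common (locally finite, as they are finite) Taylor variety:
they share a common Taylor term with common Taylor identities. -/
def CommonTaylor (S : Signature) (A B : Type) [SAlg S A] [SAlg S B] : Prop :=
  ∃ (n : ℕ) (t : STerm S n) (u v : Fin n → Fin n → Fin 2),
    1 < n ∧ (∀ i, u i i ≠ v i i) ∧ TaylorOn S A t u v ∧ TaylorOn S B t u v

/-- The quotient of `A` by (the equivalence relation of) `θ`. -/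
abbrev ConQuot {A : Type} (θ : Set (A × A)) : Type :=
  Quot (fun a b => (a, b) ∈ θ)

/-- The class of `a` in `A/θ`. -/
def ConQuot.mk {A : Type} (θ : Set (A × A)) (a : A) : ConQuot θ :=
  Quot.mk _ a

/-- The quotient algebra structure on `A/θ` (extensionally correct when `θ` is a
congruence). -/
noncomputable def quotAlg {S : Signature} {A : Type} (iA : SAlg S A) (θ : Set (A × A)) :
    SAlg S (ConQuot θ) :=
  ⟨fun o x => ConQuot.mk θ
    (@SAlg.interp S A iA o fun i => Classical.choose (Quot.exists_rep (x i)))⟩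

/-- `f` is a homomorphism with respect to the given algebra structures. -/
def IsHomI {S : Signature} {A B : Type} (iA : SAlg S A) (iB : SAlg S B) (f : A → B) : Prop :=
  ∀ (o : S.ops) (x : Fin (S.arity o) → A),
    f (@SAlg.interp S A iA o x) = @SAlg.interp S B iB o fun i => f (x i)

/-- The two algebras are isomorphic. -/
def IsoAlgI {S : Signature} {A B : Type} (iA : SAlg S A) (iB : SAlg S B) : Prop :=
  ∃ f : A ≃ B, IsHomI iA iB f

/-- The identity bridge `I_{(A,ρ,L)}`. -/
def idBridge {A : Type} (ρ L : Set (A × A)) : Set (A × A × A × A) :=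
  {p | (p.1, p.2.1) ∈ L ∧ (p.2.2.1, p.2.2.2) ∈ L ∧ (p.1, p.2.2.1) ∈ ρ ∧ (p.2.1, p.2.2.2) ∈ ρ}

/-- Composition of quaternary relations (bridges). -/
def bComp {A B C : Type} (T : Set (A × A × B × B)) (T' : Set (B × B × C × C)) :
    Set (A × A × C × C) :=
  {p | ∃ b₁ b₂, (p.1, p.2.1, b₁, b₂) ∈ T ∧ (b₁, b₂, p.2.2.1, p.2.2.2) ∈ T'}

/-- Converse of a quaternary relation (bridge). -/
def bConv {A B : Type} (T : Set (A × A × B × B)) : Set (B × B × A × A) :=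
  {p | (p.2.2.1, p.2.2.2, p.1, p.2.1) ∈ T}

/-- `Δ♭_{θ,α}`: the congruence `Δ_{θ,α}` of `A(θ)` viewed as a quaternary relation. -/
def deltaFlat (S : Signature) {A : Type} [SAlg S A] (θ α : Set (A × A)) :
    Set (A × A × A × A) :=
  {p | ((p.1, p.2.1), (p.2.2.1, p.2.2.2)) ∈ DeltaCon S θ α}

/-- `T^opt_{(A,ρ)} = I_{(A,ρ,ρ⁺)} ∘ Δ♭_{ρ⁺,(ρ:ρ⁺)} ∘ I_{(A,ρ,ρ⁺)}`. -/
def Topt (S : Signature) {A : Type} [SAlg S A] (ρ ρplus : Set (A × A)) :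
    Set (A × A × A × A) :=
  bComp (idBridge ρ ρplus)
    (bComp (deltaFlat S ρplus (centralizer S ρ ρplus)) (idBridge ρ ρplus))

/-- `A` is subdirectly irreducible with monolith `μ`. -/
def IsMonolith (S : Signature) {A : Type} [SAlg S A] (μ : Set (A × A)) : Prop :=
  IsCongruence S μ ∧ μ ≠ diag A ∧ ∀ θ, IsCongruence S θ → θ ≠ diag A → μ ⊆ θ

/-- The carrier of `D(A,θ)`-style quotients: `A(μ)/Δ_{μ,α}`. -/
abbrev DCar (S : Signature) (A : Type) [SAlg S A] (μ α : Set (A × A)) : Type :=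
  Quot (fun p q : ↥μ => ((p : A × A), (q : A × A)) ∈ DeltaCon S μ α)

/-- The class of a pair `p ∈ μ` in `A(μ)/Δ_{μ,α}`. -/
def DCar.mk (S : Signature) (A : Type) [SAlg S A] (μ α : Set (A × A)) (p : ↥μ) :
    DCar S A μ α :=
  Quot.mk _ p

/-- The algebra structure on `A(μ)/Δ_{μ,α}` (extensionally correct when `μ` is a
congruence and `Δ_{μ,α}` is a congruence of `A(μ)`). -/
noncomputable def DAlg (S : Signature) (A : Type) [SAlg S A] (μ α : Set (A × A))
    (h : IsSubuniverse S μ) : SAlg S (DCar S A μ α) :=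
  letI := subAlg μ h
  ⟨fun o x => DCar.mk S A μ α
    (SAlg.interp o fun i => Classical.choose (Quot.exists_rep (x i)))⟩

/-- The canonical similarity bridge `T_{D(A)}` from `A` to `D(A)`. -/
def TDBridge (S : Signature) (A : Type) [SAlg S A] (μ α : Set (A × A)) :
    Set (A × A × DCar S A μ α × DCar S A μ α) :=
  {x | ∃ (a b e : A) (_ : (a, b) ∈ μ) (h1 : (a, e) ∈ μ) (h2 : (b, e) ∈ μ),
    x = (a, b, DCar.mk S A μ α ⟨(a, e), h1⟩, DCar.mk S A μ α ⟨(b, e), h2⟩)}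

/-- Similarity of (subdirectly irreducible) algebras: `D(A) ≅ D(B)`, where `D(X)` is
`X(μ)/Δ_{μ,(0:μ)}` if the monolith `μ` is abelian, and `X` itself otherwise. -/
def SimilarI (S : Signature) {A B : Type} (iA : SAlg S A) (iB : SAlg S B) : Prop :=
  letI := iA
  letI := iB
  ∃ (μA : Set (A × A)) (μB : Set (B × B)) (hA : IsMonolith S μA) (hB : IsMonolith S μB),
    ((Centralizes S μA μA (diag A) ∧ Centralizes S μB μB (diag B)) →
      IsoAlgI (DAlg S A μA (centralizer S (diag A) μA) hA.1.1)
        (DAlg S B μB (centralizer S (diag B) μB) hB.1.1)) ∧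
    ((Centralizes S μA μA (diag A) ∧ ¬ Centralizes S μB μB (diag B)) →
      IsoAlgI (DAlg S A μA (centralizer S (diag A) μA) hA.1.1) iB) ∧
    ((¬ Centralizes S μA μA (diag A) ∧ Centralizes S μB μB (diag B)) →
      IsoAlgI iA (DAlg S B μB (centralizer S (diag B) μB) hB.1.1)) ∧
    ((¬ Centralizes S μA μA (diag A) ∧ ¬ Centralizes S μB μB (diag B)) →
      IsoAlgI iA iB)

end Zhuk

namespace Zhuk

/-- The coefficient vectors of the ternary operations generated by the linear
operation `∑ i, l i * x i`. -/
inductive LinClone {R : Type*} [Ring R] {n : ℕ} (l : Fin n → R) : R → R → R → Prop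
  | fst : LinClone l 1 0 0
  | snd : LinClone l 0 1 0
  | trd : LinClone l 0 0 1
  | app (a b c : Fin n → R) (h : ∀ i, LinClone l (a i) (b i) (c i)) :
      LinClone l (∑ i, l i * a i) (∑ i, l i * b i) (∑ i, l i * c i)

namespace LinClone

variable {R : Type*} [Ring R] {n : ℕ} {l : Fin n → R}

theorem cast {a b c a' b' c' : R} (h : LinClone l a b c) (ha : a = a') (hb : b = b')
    (hc : c = c') : LinClone l a' b' c' := by
  subst ha hb hc; exact h

theorem subst {a b c a₁ b₁ c₁ a₂ b₂ c₂ a₃ b₃ c₃ : R} (h : LinClone l a b c)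
    (h₁ : LinClone l a₁ b₁ c₁) (h₂ : LinClone l a₂ b₂ c₂) (h₃ : LinClone l a₃ b₃ c₃) :
    LinClone l (a * a₁ + b * a₂ + c * a₃) (a * b₁ + b * b₂ + c * b₃)
      (a * c₁ + b * c₂ + c * c₃) := by
  induction h with
  | fst => simpa using h₁
  | snd => simpa using h₂
  | trd => simpa using h₃
  | app a b c _ ih =>
    refine (app _ _ _ ih).cast ?_ ?_ ?_ <;>
    simp only [Finset.sum_mul, ← Finset.sum_add_distrib, mul_add, mul_assoc]

theorem sum_eq_one (hl : ∑ i, l i = 1) {a b c : R} (h : LinClone l a b c) :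
    a + b + c = 1 := by
  induction h with
  | fst => simp
  | snd => simp
  | trd => simp
  | app a b c _ ih => simp [← Finset.sum_add_distrib, ← mul_add, ih, hl]

/-- The term `x ↦ r x - r y + z` belongs to the clone. -/
def Shift (l : Fin n → R) (r : R) : Prop := LinClone l r (-r) 1

/-- The term `(1 - q) x + q y` belongs to the clone. -/
def Mix (l : Fin n → R) (q : R) : Prop := LinClone l (1 - q) q 0

theorem shift_zero : Shift l 0 := trd.cast rfl (by simp) rfl

theorem Shift.neg {r : R} (h : Shift l r) : Shift l (-r) :=
  (subst h snd fst trd).cast (by simp) (by simp) (by simp)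

theorem Shift.add {r s : R} (hr : Shift l r) (hs : Shift l s) : Shift l (r + s) :=
  (subst hr fst snd hs).cast (by noncomm_ring) (by noncomm_ring) (by noncomm_ring)

theorem Shift.sub {r s : R} (hr : Shift l r) (hs : Shift l s) : Shift l (r - s) := by
  simpa [sub_eq_add_neg] using hr.add hs.neg

theorem Shift.sum {ι : Type*} (s : Finset ι) (r : ι → R) (h : ∀ i ∈ s, Shift l (r i)) :
    Shift l (∑ i ∈ s, r i) := by
  classical
  induction s using Finset.induction_on with
  | empty => simpa using shift_zero
  | insert i s hi ih =>
    rw [Finset.sum_insert hi]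
    exact (h i (by simp)).add (ih fun j hj => h j (by simp [hj]))

theorem Shift.mul_mix {r q : R} (hr : Shift l r) (hq : Mix l q) : Shift l (r * q) :=
  (subst hr fst hq trd).cast (by noncomm_ring) (by noncomm_ring) (by noncomm_ring)

theorem Mix.mul_shift {r q : R} (hq : Mix l q) (hr : Shift l r) : Shift l (q * r) :=
  (subst hq trd hr trd).cast (by noncomm_ring) (by noncomm_ring) (by noncomm_ring)

theorem Mix.mul {q q' : R} (hq : Mix l q) (hq' : Mix l q') : Mix l (q * q') :=
  (subst hq fst hq' trd).cast (by noncomm_ring) (by noncomm_ring) (by noncomm_ring)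

theorem Mix.compl {q : R} (hq : Mix l q) : Mix l (1 - q) :=
  (subst hq snd fst trd).cast (by noncomm_ring) (by noncomm_ring) (by noncomm_ring)

theorem Mix.pow {q : R} (hq : Mix l q) (k : ℕ) : Mix l (q ^ k) := by
  induction k with
  | zero => exact snd.cast (by simp) (by simp) rfl
  | succ k ih => rw [pow_succ]; exact ih.mul hq

/-- A shift may be added to the first coefficient and subtracted from the second. -/
theorem add_shift {a b c r : R} (h : LinClone l a b c) (hr : Shift l r) :
    LinClone l (a + r) (b - r) c :=
  (subst hr fst snd h).cast (by noncomm_ring) (by noncomm_ring) (by noncomm_ring)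

theorem rotate {a b c : R} (h : LinClone l a b c) : LinClone l c a b :=
  (subst h snd trd fst).cast (by simp) (by simp) (by simp)

theorem mix_sum (hl : ∑ i, l i = 1) (s : Finset (Fin n)) : Mix l (∑ i ∈ s, l i) := by
  classical
  refine (app (fun i => if i ∈ s then 0 else 1) (fun i => if i ∈ s then 1 else 0) (fun _ => 0)
    fun i => ?_).cast ?_ ?_ ?_
  · by_cases hi : i ∈ s <;> simp [hi, fst, snd]
  · rw [eq_sub_iff_add_eq]
    refine Eq.trans ?_ ((Finset.sum_filter_add_sum_filter_not Finset.univ (· ∈ s) l).trans hl)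
    simp only [mul_ite, mul_zero, mul_one, Finset.sum_ite]
    simp [add_comm]
  · simp
  · simp

variable [Finite R]

theorem Mix.exists_compl_pow_mul {q : R} (hq : Mix l q) :
    ∃ M, Shift l ((1 - q) ^ M * q) := by
  obtain ⟨j, j', hne, he⟩ := Finite.exists_ne_map_eq_of_infinite fun k : ℕ => (1 - q) ^ k
  wlog hlt : j < j' generalizing j j'
  · exact this j' j hne.symm he.symm (by omega)
  obtain ⟨k, rfl⟩ := Nat.exists_eq_add_of_lt hlt
  refine ⟨j + k, ?_⟩
  have h₁ : LinClone l q 0 (1 - q) :=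
    (subst hq trd fst trd).cast (by simp) (by simp) (by simp)
  have h₂ := subst (hq.compl.pow k) snd h₁ trd
  have h₃ := subst (hq.compl.pow j) trd h₂ trd
  have e : (1 - q) ^ (j + k) * q = (1 - q) ^ (j + k) - (1 - q) ^ j := by
    rw [he, pow_succ _ (j + k)]; noncomm_ring
  refine h₃.cast ?_ ?_ ?_
  · simp [pow_add, mul_assoc]
  · rw [e, pow_add]; noncomm_ring
  · have : (1 - q) ^ j * ((1 - q) ^ k * (1 - q)) = (1 - q) ^ j := by
      rw [← pow_succ, ← pow_add, ← add_assoc, ← he]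
    simp [this]

theorem Mix.mul_compl {q : R} (hq : Mix l q) : Shift l (q * (1 - q)) := by
  obtain ⟨M, hM⟩ := hq.exists_compl_pow_mul
  obtain ⟨M', hM'⟩ := hq.compl.exists_compl_pow_mul
  rw [sub_sub_cancel] at hM'
  have hc : Commute q (1 - q) := (Commute.one_right q).sub_right (Commute.refl q)
  have key : ∀ k i j, M + M' ≤ i + j + k → Shift l (q ^ (i + 1) * (1 - q) ^ (j + 1)) := by
    intro k
    induction k with
    | zero =>
      intro i j h
      rcases le_or_gt M' i with hi | hi
      · obtain ⟨i, rfl⟩ := Nat.exists_eq_add_of_le hi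
        have := ((hq.pow (i + 1)).mul_shift hM').mul_mix (hq.compl.pow j)
        convert this using 1
        rw [pow_succ' (1 - q) j, ← mul_assoc, ← mul_assoc, ← pow_add]
        congr 3; omega
      · obtain ⟨j, rfl⟩ := Nat.exists_eq_add_of_le (show M ≤ j by omega)
        have := ((hq.pow i).mul_shift (hq.compl.pow (j + 1) |>.mul_shift hM))
        convert this using 1
        rw [← mul_assoc ((1 - q) ^ (j + 1)), ← pow_add, ← (hc.pow_right _).eq, pow_succ,
          mul_assoc]
        congr 3; omega
    | succ k ih =>
      intro i j h
      have := (ih (i + 1) j (by omega)).add (ih i (j + 1) (by omega))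
      convert this using 1
      rw [pow_succ' _ (j + 1), pow_succ q (i + 1), mul_assoc _ q, ← mul_add, ← add_mul]
      simp
  simpa using key (M + M') 0 0 (by omega)

theorem shift_mul_of_ne (hl : ∑ i, l i = 1) {i j : Fin n} (hij : i ≠ j) : Shift l (l i * l j) := by
  classical
  set a := l i with ha
  set b := l j with hb
  have hA : Mix l a := by simpa using mix_sum hl {i}
  have hB : Mix l b := by simpa using mix_sum hl {j}
  have hAB : Mix l (a + b) := by simpa [Finset.sum_pair hij] using mix_sum hl {i, j}
  have hanti : Shift l (a * b + b * a) := by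
    convert (hA.mul_compl.add hB.mul_compl).sub hAB.mul_compl using 1
    noncomm_ring
  have h₁ : LinClone l a b (1 - a - b) := by
    have h₀ := app (l := l) (fun k => if k = i then 1 else 0) (fun k => if k = j then 1 else 0)
      (fun k => if k = i ∨ k = j then 0 else 1) fun k => by
        by_cases hi : k = i
        · subst hi; simp [hij, fst]
        · by_cases hj : k = j
          · subst hj; simp [hi, snd]
          · simp [hi, hj, trd]
    have h₂ := h₀.sum_eq_one hl
    have ea : ∑ k, l k * (if k = i then (1 : R) else 0) = a := by simp [ha]
    have eb : ∑ k, l k * (if k = j then (1 : R) else 0) = b := by simp [hb]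
    refine h₀.cast ea eb ?_
    rw [ea, eb] at h₂
    rw [sub_sub, eq_sub_iff_add_eq, add_comm]; exact h₂
  have h₂ := subst (hA.mul hB) snd h₁ trd
  have d₁ : Shift l (a * b * a + a * b) := by
    convert (hA.mul_shift hanti).add (hA.mul_compl.mul_mix hB) using 1
    noncomm_ring
  have d₂ : Shift l (a * b * b - a * b) := by
    convert (hA.mul_shift hB.mul_compl).neg using 1
    noncomm_ring
  refine (((h₂.rotate.add_shift d₁).rotate.add_shift d₂.neg).rotate.rotate).cast ?_ ?_ ?_ <;>
    noncomm_ring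

/-- A finite linear idempotent Taylor operation generates the Maltsev operation `x - y + z`. -/
theorem malcev_of_taylor (hl : ∑ i, l i = 1)
    (ht : ∀ i, ∃ P Q : Finset (Fin n), i ∈ P ∧ i ∉ Q ∧ ∑ j ∈ P, l j = ∑ j ∈ Q, l j) :
    LinClone l 1 (-1) 1 := by
  classical
  have h : ∀ i, Shift l (l i) := by
    intro i
    obtain ⟨P, Q, hP, hQ, he⟩ := ht i
    have hi : Mix l (l i) := by simpa using mix_sum hl {i}
    have hq : Shift l (∑ j ∈ Q, l i * l j) := Shift.sum _ _ fun j hj =>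
      shift_mul_of_ne hl (by rintro rfl; exact hQ hj)
    have hp : Shift l (∑ j ∈ P.erase i, l i * l j) := Shift.sum _ _ fun j hj =>
      shift_mul_of_ne hl (Finset.ne_of_mem_erase hj).symm
    have := hi.mul_compl.add (hq.sub hp)
    rw [← Finset.mul_sum, ← he, ← Finset.add_sum_erase _ _ hP, ← Finset.mul_sum] at this
    convert this using 1
    noncomm_ring
  have := Shift.sum Finset.univ l fun i _ => h i
  rwa [hl] at this

end LinClone
end Zhuk

namespace Zhuk

variable {S : Signature} {Q X Y : Type} [SAlg S Q]

/-- The functions `X → Q` obtained from those in `V` and the constants by applying the basic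
operations; for a suitable set `V` of projections these are the polynomial operations of `Q`. -/
inductive Pol (S : Signature) {Q X : Type} [SAlg S Q] (V : Set (X → Q)) : (X → Q) → Prop
  | gen (v : X → Q) : v ∈ V → Pol S V v
  | const (c : Q) : Pol S V fun _ => c
  | app (o : S.ops) (f : Fin (S.arity o) → X → Q) :
      (∀ i, Pol S V (f i)) → Pol S V fun x => SAlg.interp o fun i => f i x

/-- Unary polynomial operations. -/
abbrev UPol (S : Signature) {Q : Type} [SAlg S Q] (p : Q → Q) : Prop := Pol S {id} p

namespace Pol

variable {V : Set (X → Q)} {W : Set (Y → Q)} {f : X → Q}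

theorem comp (hf : Pol S V f) {g : Y → X} (hg : ∀ v ∈ V, Pol S W fun y => v (g y)) :
    Pol S W fun y => f (g y) := by
  induction hf with
  | gen v hv => exact hg v hv
  | const c => exact const c
  | app o f _ ih => exact app o (fun i y => f i (g y)) ih

theorem unary {p : Q → Q} (hp : UPol S p) (hf : Pol S V f) : Pol S V fun x => p (f x) :=
  hp.comp (by rintro v rfl; exact hf)

theorem term {n : ℕ} (t : STerm S n) {g : Fin n → X → Q} (hg : ∀ i, Pol S V (g i)) :
    Pol S V fun x => t.eval fun i => g i x := by
  induction t with
  | var i => exact hg i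
  | app o ts ih => exact app o _ ih

theorem pair_mem {R : Set (Q × Q)} (hR : IsSubuniverse S R) (hr : ∀ c, (c, c) ∈ R)
    (hf : Pol S V f) {x y : X} (h : ∀ v ∈ V, (v x, v y) ∈ R) : (f x, f y) ∈ R := by
  induction hf with
  | gen v hv => exact h v hv
  | const c => exact hr c
  | app o f _ ih => exact hR o (fun i => (f i x, f i y)) ih

theorem quad_mem {T : Set (Q × Q × Q × Q)} (hT : IsSubuniverse S T)
    (hr : ∀ c, (c, c, c, c) ∈ T) (hf : Pol S V f) {x y z w : X}
    (h : ∀ v ∈ V, (v x, v y, v z, v w) ∈ T) : (f x, f y, f z, f w) ∈ T := by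
  induction hf with
  | gen v hv => exact h v hv
  | const c => exact hr c
  | app o f _ ih => exact hT o (fun i => (f i x, f i y, f i z, f i w)) ih

end Pol

theorem UPol.id : UPol S (id : Q → Q) := .gen _ rfl

theorem UPol.iterate {p : Q → Q} (hp : UPol S p) (k : ℕ) : UPol S p^[k] := by
  induction k with
  | zero => exact .id
  | succ k ih => rw [Function.iterate_succ']; exact hp.unary ih

/-- An equivalence relation preserved by the unary polynomials is a congruence. -/
theorem isCongruence_of_unary {E : Set (Q × Q)} (hE : Equivalence fun a b => (a, b) ∈ E)
    (h : ∀ p, UPol S p → ∀ x y, (x, y) ∈ E → (p x, p y) ∈ E) : IsCongruence S E := by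
  classical
  refine ⟨fun o x hx => ?_, hE⟩
  have key : ∀ s : Finset (Fin (S.arity o)), (SAlg.interp o fun i => (x i).1,
      SAlg.interp o fun i => if i ∈ s then (x i).2 else (x i).1) ∈ E := by
    intro s
    induction s using Finset.induction_on with
    | empty => simpa using hE.refl _
    | insert k s hk ih =>
      refine hE.trans ih ?_
      have hp : UPol S fun z : Q => SAlg.interp o fun i =>
          if i = k then z else if i ∈ s then (x i).2 else (x i).1 := by
        refine .app o (fun i z => if i = k then z else if i ∈ s then (x i).2 else (x i).1)
          fun i => ?_
        by_cases hi : i = k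
        · simp only [hi, if_true]; exact UPol.id
        · simpa [hi] using Pol.const (S := S) (V := {id}) (if i ∈ s then (x i).2 else (x i).1)
      convert h _ hp _ _ (hx k) using 3 <;> funext i <;> by_cases hi : i = k
      all_goals first | (subst hi; simp [hk]) | simp [hi]
  have := key Finset.univ
  simp only [Finset.mem_univ, if_true] at this
  exact this

theorem exists_uniform_idempotent_iterate (Q : Type) [Finite Q] :
    ∃ k, ∀ (p : Q → Q) (x : Q), p^[k + 1] (p^[k + 1] x) = p^[k + 1] x := by
  classical
  have single : ∀ p : Q → Q, ∃ k, 0 < k ∧ ∀ m x, p^[k * (m + 1)] x = p^[k] x := by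
    intro p
    obtain ⟨i, j, hne, he⟩ := Finite.exists_ne_map_eq_of_infinite fun k : ℕ => p^[k]
    wlog hlt : i < j generalizing i j
    · exact this j i hne.symm he.symm (by omega)
    obtain ⟨d, rfl⟩ := Nat.exists_eq_add_of_lt hlt
    have step : ∀ m, i ≤ m → p^[m + (d + 1)] = p^[m] := by
      intro m hm
      obtain ⟨r, rfl⟩ := Nat.exists_eq_add_of_le' hm
      have he' : p^[i + d + 1] = p^[i] := he.symm
      rw [add_assoc, Function.iterate_add, ← add_assoc i, he', ← Function.iterate_add]
    refine ⟨(d + 1) * (i + 1), by positivity, fun m x => ?_⟩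
    have hle : i ≤ (d + 1) * (i + 1) := by nlinarith
    have many : ∀ r, p^[(d + 1) * (i + 1) + (d + 1) * r] = p^[(d + 1) * (i + 1)] := by
      intro r
      induction r with
      | zero => simp
      | succ r ih => rw [mul_add _ r, mul_one, ← add_assoc, step _ (by omega), ih]
    rw [← many ((i + 1) * m)]
    congr 2
    ring
  choose k hk hk' using single
  have := Fintype.ofFinite (Q → Q)
  have hpos : 0 < ∏ p, k p := Finset.prod_pos fun p _ => hk p
  obtain ⟨K, hK⟩ := Nat.exists_eq_succ_of_ne_zero hpos.ne'
  refine ⟨K, fun p x => ?_⟩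
  obtain ⟨r, hr⟩ : k p ∣ K + 1 := by
    rw [← Nat.succ_eq_add_one, ← hK]; exact Finset.dvd_prod_of_mem k (Finset.mem_univ p)
  obtain ⟨r, rfl⟩ := Nat.exists_eq_succ_of_ne_zero (show r ≠ 0 by rintro rfl; simp at hr)
  rw [hr, ← Function.iterate_add_apply, hk' p r x]
  convert hk' p (2 * r + 1) x using 2
  rw [Nat.succ_eq_add_one]; ring

end Zhuk

namespace Zhuk

variable {S : Signature} {Q X Y : Type} [SAlg S Q]

/-- `μ` is the monolith, `τ ⊆ μ` is a minimal nontrivial reflexive subuniverse of `Q²`, and `T`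
witnesses, through the term condition, that `μ` centralizes `τ`. -/
structure CentralCover (S : Signature) {Q : Type} [SAlg S Q] (μ τ : Set (Q × Q))
    (T : Set (Q × Q × Q × Q)) : Prop where
  con : IsCongruence S μ
  monolith : ∀ θ, IsCongruence S θ → (∃ x y, x ≠ y ∧ (x, y) ∈ θ) → μ ⊆ θ
  sub : τ ⊆ μ
  subuniverse : IsSubuniverse S τ
  refl : ∀ c, (c, c) ∈ τ
  nontrivial : ∃ c d, c ≠ d ∧ (c, d) ∈ τ
  minimal : ∀ τ', IsSubuniverse S τ' → (∀ c, (c, c) ∈ τ') → τ' ⊆ τ →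
    (∃ c d, c ≠ d ∧ (c, d) ∈ τ') → τ' = τ
  subuniverse_quad : IsSubuniverse S T
  row : ∀ a b, (a, b) ∈ μ → (a, a, b, b) ∈ T
  col : ∀ c d, (c, d) ∈ τ → (c, d, c, d) ∈ T
  eq_of_mem : ∀ x z w, (x, x, z, w) ∈ T → z = w

/-- `e` is an idempotent unary polynomial, minimal among those that do not collapse `τ`, and it
fixes the elements `a ≠ b` with `(a, b) ∈ τ`. -/
structure MinIdem (S : Signature) {Q : Type} [SAlg S Q] (τ : Set (Q × Q)) (e : Q → Q)
    (a b : Q) : Prop where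
  pol : UPol S e
  idem : ∀ x, e (e x) = e x
  mem : (a, b) ∈ τ
  ne : a ≠ b
  left : e a = a
  right : e b = b
  minimal : ∀ h, UPol S h → (∀ x, h (h x) = h x) → (∀ x, e (h x) = h x) →
    (∃ c d, (c, d) ∈ τ ∧ h c ≠ h d) → ∀ x, e x = x → h x = x

/-- The trace of a congruence `μ` on the range of `e` around `a`. -/
def traceSet (μ : Set (Q × Q)) (e : Q → Q) (a : Q) : Set Q := {x | e x = x ∧ (a, x) ∈ μ}

variable {μ τ : Set (Q × Q)} {T : Set (Q × Q × Q × Q)} {e : Q → Q} {a b : Q}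

namespace CentralCover

theorem pol_mem (h : CentralCover S μ τ T) {V : Set (X → Q)} {f : X → Q} (hf : Pol S V f)
    {x y : X} (hxy : ∀ v ∈ V, (v x, v y) ∈ τ) : (f x, f y) ∈ τ :=
  hf.pair_mem h.subuniverse h.refl hxy

theorem pol_mem_con (h : CentralCover S μ τ T) {V : Set (X → Q)} {f : X → Q} (hf : Pol S V f)
    {x y : X} (hxy : ∀ v ∈ V, (v x, v y) ∈ μ) : (f x, f y) ∈ μ :=
  hf.pair_mem h.con.1 h.con.2.refl hxy

theorem pol_quad (h : CentralCover S μ τ T) {V : Set (X → Q)} {f : X → Q} (hf : Pol S V f)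
    {x y z w : X} (hv : ∀ v ∈ V, (v x, v y, v z, v w) ∈ T) : (f x, f y, f z, f w) ∈ T :=
  hf.quad_mem h.subuniverse_quad (fun c => h.row c c (h.con.2.refl c)) hv

theorem pol_eq (h : CentralCover S μ τ T) {V : Set (X → Q)} {f : X → Q} (hf : Pol S V f)
    {x y z w : X} (hv : ∀ v ∈ V, (v x, v y, v z, v w) ∈ T) (he : f x = f y) : f z = f w := by
  have := h.pol_quad hf hv
  rw [he] at this
  exact h.eq_of_mem _ _ _ this

theorem upol_mem (h : CentralCover S μ τ T) {p : Q → Q} (hp : UPol S p) {c d : Q}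
    (hcd : (c, d) ∈ τ) : (p c, p d) ∈ τ :=
  h.pol_mem hp (by rintro v rfl; exact hcd)

theorem upol_mem_con (h : CentralCover S μ τ T) {p : Q → Q} (hp : UPol S p) {c d : Q}
    (hcd : (c, d) ∈ μ) : (p c, p d) ∈ μ :=
  h.pol_mem_con hp (by rintro v rfl; exact hcd)

/-- Every nontrivial pair of `τ` generates `τ`. -/
theorem exists_upol (h : CentralCover S μ τ T) {c d : Q} (hcd : (c, d) ∈ τ) (hne : c ≠ d)
    {x y : Q} (hxy : (x, y) ∈ τ) : ∃ p, UPol S p ∧ p c = x ∧ p d = y := by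
  have := h.minimal {q | ∃ p, UPol S p ∧ p c = q.1 ∧ p d = q.2} ?_ ?_ ?_ ?_
  · rw [← this] at hxy; exact hxy
  · intro o q hq
    choose p hp h1 h2 using hq
    refine ⟨_, .app o p hp, ?_, ?_⟩
    · simp only [h1]; rfl
    · simp only [h2]; rfl
  · exact fun r => ⟨_, .const r, rfl, rfl⟩
  · rintro ⟨x, y⟩ ⟨p, hp, rfl, rfl⟩
    exact h.upol_mem hp hcd
  · exact ⟨c, d, hne, _, .id, rfl, rfl⟩

theorem exists_minIdem [Finite Q] (h : CentralCover S μ τ T) : ∃ e a b, MinIdem S τ e a b := by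
  classical
  let P : ℕ → Prop := fun n => ∃ e : Q → Q, UPol S e ∧ (∀ x, e (e x) = e x) ∧
    (∃ c d, (c, d) ∈ τ ∧ e c ≠ e d) ∧ (Set.range e).ncard = n
  have hP : ∃ n, P n := by
    obtain ⟨c, d, hne, hcd⟩ := h.nontrivial
    exact ⟨_, _, .id, fun _ => rfl, ⟨c, d, hcd, hne⟩, rfl⟩
  obtain ⟨e, he, hi, ⟨c, d, hcd, hne⟩, hn⟩ := Nat.find_spec hP
  refine ⟨e, e c, e d, he, hi, h.upol_mem he hcd, hne, hi c, hi d, fun g hg hgi heg hgn x hx => ?_⟩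
  have hsub : Set.range g ⊆ Set.range e := by
    rintro _ ⟨y, rfl⟩; exact ⟨g y, heg y⟩
  have hle : (Set.range e).ncard ≤ (Set.range g).ncard := by
    rw [hn]; exact Nat.find_min' hP ⟨g, hg, hgi, hgn, rfl⟩
  have heq := Set.eq_of_subset_of_ncard_le hsub hle (Set.toFinite _)
  obtain ⟨y, rfl⟩ : x ∈ Set.range g := heq ▸ ⟨x, hx⟩
  exact hgi y

end CentralCover

namespace MinIdem

theorem apply_mem (m : MinIdem S τ e a b) (h : CentralCover S μ τ T) {x : Q}
    (hx : (a, x) ∈ μ) : e x ∈ traceSet μ e a := by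
  refine ⟨m.idem x, ?_⟩
  have := h.upol_mem_con m.pol hx
  rwa [m.left] at this

theorem left_mem (m : MinIdem S τ e a b) (h : CentralCover S μ τ T) : a ∈ traceSet μ e a :=
  ⟨m.left, h.con.2.refl a⟩

theorem right_mem (m : MinIdem S τ e a b) (h : CentralCover S μ τ T) : b ∈ traceSet μ e a :=
  ⟨m.right, h.sub m.mem⟩

/-- A unary polynomial separating a `τ`-pair in the range of `e` is injective on that range. -/
theorem injOn [Finite Q] (m : MinIdem S τ e a b) (h : CentralCover S μ τ T) {p : Q → Q}
    (hp : UPol S p) {c d : Q} (hcd : (c, d) ∈ τ) (hc : e c = c) (hd : e d = d)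
    (hne : p c ≠ p d) {x y : Q} (hx : e x = x) (hy : e y = y) (hxy : p x = p y) : x = y := by
  obtain ⟨q, hq, hqc, hqd⟩ := h.exists_upol (h.upol_mem hp hcd) hne hcd
  obtain ⟨k, hk⟩ := exists_uniform_idempotent_iterate Q
  let g : Q → Q := fun z => e (q (p z))
  have hg : UPol S g := m.pol.unary (hq.unary hp) |>.comp (by rintro v rfl; exact .gen _ rfl)
  have hgc : g c = c := by simp [g, hqc, hc]
  have hgd : g d = d := by simp [g, hqd, hd]
  have key : ∀ z, e z = z → g^[k + 1] z = z := by
    refine m.minimal _ (hg.iterate _) (hk g) (fun z => ?_) ⟨c, d, hcd, ?_⟩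
    · rw [Function.iterate_succ_apply']; exact m.idem _
    · rw [Function.iterate_fixed hgc, Function.iterate_fixed hgd]
      rintro rfl; exact hne rfl
  have hgxy : g x = g y := by simp [g, hxy]
  rw [← key x hx, ← key y hy, Function.iterate_succ_apply, Function.iterate_succ_apply, hgxy]

/-- The trace of the minimal congruence carries a polynomial quasigroup operation. -/
theorem exists_quasigroup [Finite Q] (m : MinIdem S τ e a b) (h : CentralCover S μ τ T) {n : ℕ}
    {t : STerm S n} {u v : Fin n → Fin n → Fin 2} (hn : 1 < n) (huv : ∀ i, u i i ≠ v i i)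
    (ht : TaylorOn S Q t u v) :
    ∃ f : Q → Q → Q, Pol S {Prod.fst, Prod.snd} (fun z : Q × Q => f z.1 z.2) ∧
      (∀ x ∈ traceSet μ e a, ∀ y ∈ traceSet μ e a, f x y ∈ traceSet μ e a) ∧
      (∀ x ∈ traceSet μ e a, Set.InjOn (f x) (traceSet μ e a)) ∧
      (∀ y ∈ traceSet μ e a, Set.InjOn (fun x => f x y) (traceSet μ e a)) := by
  classical
  set N := traceSet μ e a with hN
  have haN := m.left_mem h
  have hbN := m.right_mem h
  have hNμ : ∀ {x y}, x ∈ N → y ∈ N → (x, y) ∈ μ := fun hx hy =>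
    h.con.2.trans (h.con.2.symm hx.2) hy.2
  let F : (Fin n → Q) → Q := fun x => e (t.eval x)
  have hF : Pol S (Set.range fun (i : Fin n) (x : Fin n → Q) => x i) F :=
    m.pol.unary (Pol.term t (g := fun i (x : Fin n → Q) => x i) fun i => .gen _ ⟨i, rfl⟩)
  have hFc : ∀ c ∈ N, F (fun _ => c) = c := fun c hc => by
    simp only [F, ht.1]; exact hc.1
  let act : Fin n → Prop := fun i => ∃ x : Fin n → Q, (∀ j, x j ∈ N) ∧
    F (Function.update x i a) ≠ F (Function.update x i b)
  have hinj : ∀ i, act i → ∀ x : Fin n → Q, (∀ j, x j ∈ N) →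
      Set.InjOn (fun z => F (Function.update x i z)) N := by
    rintro i ⟨x₀, hx₀, hne⟩ x hx z hz w hw hzw
    have hp : UPol S fun z => F (Function.update x i z) := by
      refine hF.comp ?_
      rintro _ ⟨j, rfl⟩
      by_cases hj : j = i
      · subst hj; simp only [Function.update_self]; exact UPol.id
      · simpa [hj] using Pol.const (S := S) (V := {id}) (x j)
    refine m.injOn h hp m.mem m.left m.right ?_ hz.1 hw.1 hzw
    intro hab
    refine hne (h.pol_eq hF ?_ hab)
    rintro _ ⟨j, rfl⟩
    by_cases hj : j = i
    · subst hj; simpa using h.col a b m.mem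
    · simpa [hj] using h.row _ _ (hNμ (hx j) (hx₀ j))
  have htwo : ∃ i j, i ≠ j ∧ act i ∧ act j := by
    by_contra hcon
    push Not at hcon
    obtain ⟨i₀, hi₀⟩ : ∃ i₀, ∀ i, i ≠ i₀ → ¬ act i := by
      by_cases hex : ∃ i, act i
      · obtain ⟨i, hi⟩ := hex
        exact ⟨i, fun j hj hj' => hcon j i hj hj' hi⟩
      · exact ⟨⟨0, by omega⟩, fun i _ hi => hex ⟨i, hi⟩⟩
    have hproj : ∀ x : Fin n → Q, (∀ j, x j = a ∨ x j = b) → F x = x i₀ := by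
      intro x hx
      have hxN : ∀ j, x j ∈ N := fun j => by
        rcases hx j with hj | hj <;> rw [hj] <;> assumption
      have key : ∀ s : Finset (Fin n), i₀ ∉ s →
          F (fun j => if j ∈ s then x j else x i₀) = x i₀ := by
        intro s
        induction s using Finset.induction_on with
        | empty => intro _; simpa using hFc _ (hxN i₀)
        | insert k s hk ih =>
          intro hs
          simp only [Finset.mem_insert, not_or] at hs
          refine Eq.trans ?_ (ih hs.2)
          set y : Fin n → Q := fun j => if j ∈ s then x j else x i₀ with hy
          have hyN : ∀ j, y j ∈ N := fun j => by
            simp only [hy]; split_ifs <;> exact hxN _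
          have hna : F (Function.update y k a) = F (Function.update y k b) := by
            by_contra hne
            exact hi₀ k (fun hk => hs.1 hk.symm) ⟨y, hyN, hne⟩
          have h1 : (fun j => if j ∈ insert k s then x j else x i₀) =
              Function.update y k (x k) := by
            funext j
            by_cases hj : j = k
            · subst hj; simp
            · simp [hj, hy]
          have h2 : y = Function.update y k (x i₀) := by
            rw [eq_comm, Function.update_eq_self_iff]; simp [hy, hk]
          rw [h1]
          conv_rhs => rw [h2]
          rcases hx k with hk | hk <;> rcases hx i₀ with h0 | h0 <;> rw [hk, h0] <;>
            first | exact hna | exact hna.symm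
      rw [← key (Finset.univ.erase i₀) (by simp)]
      congr 1
      funext j
      by_cases hj : j = i₀ <;> simp [hj]
    have h1 := hproj (fun j => if u i₀ j = 0 then a else b) fun j => by split_ifs <;> simp
    have h2 := hproj (fun j => if v i₀ j = 0 then a else b) fun j => by split_ifs <;> simp
    have h3 : F _ = F _ := congrArg e (ht.2 i₀ a b)
    rw [h1, h2] at h3
    have := huv i₀
    have := m.ne
    have := m.ne.symm
    split_ifs at h3 with c1 c2 c2 <;> first | contradiction | omega
  obtain ⟨i, j, hij, hi, hj⟩ := htwo
  let w : Q → Q → Fin n → Q := fun x y k => if k = i then x else if k = j then y else a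
  have hw1 : ∀ x x' y, w x y = Function.update (w x' y) i x := by
    intro x x' y; funext k
    by_cases hk : k = i <;> simp [w, hk]
  have hw2 : ∀ x y y', w x y = Function.update (w x y') j y := by
    intro x y y'; funext k
    by_cases hk : k = j
    · subst hk; simp [w, hij.symm]
    · simp [w, hk]
  have hwN : ∀ x ∈ N, ∀ y ∈ N, ∀ k, w x y k ∈ N := by
    intro x hx y hy k
    simp only [w]; split_ifs <;> assumption
  refine ⟨fun x y => F (w x y), ?_, ?_, ?_, ?_⟩
  · refine hF.comp (g := fun z : Q × Q => w z.1 z.2) ?_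
    rintro _ ⟨k, rfl⟩
    simp only [w]
    split_ifs
    · exact .gen _ (by simp)
    · exact .gen _ (by simp)
    · exact .const _
  · intro x hx y hy
    refine ⟨m.idem _, ?_⟩
    have := h.pol_mem_con hF (x := fun _ => a) (y := w x y) (by
      rintro _ ⟨k, rfl⟩; exact hNμ haN (hwN x hx y hy k))
    rwa [hFc a haN] at this
  · intro x hx y hy y' hy' heq
    refine hinj j hj (w x a) (hwN x hx a haN) hy hy' ?_
    simp only [← hw2]; exact heq
  · intro y hy x hx x' hx' heq
    refine hinj i hi (w a y) (hwN a haN y hy) hx hx' ?_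
    simp only [← hw1]; exact heq

end MinIdem

theorem Pol.iterate {V : Set (X → Q)} {f : Q → Q → Q}
    (hf : Pol S {Prod.fst, Prod.snd} fun z : Q × Q => f z.1 z.2) {r s : X → Q}
    (hr : Pol S V r) (hs : Pol S V s) (k : ℕ) : Pol S V fun x => (f (r x))^[k] (s x) := by
  induction k with
  | zero => exact hs
  | succ k ih =>
    simp only [Function.iterate_succ_apply']
    refine hf.comp (g := fun x => (r x, (f (r x))^[k] (s x))) ?_
    rintro v (rfl | rfl)
    · exact hr
    · exact ih

/-- The coordinate projections of `Q³`. -/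
def proj3 (Q : Type) : Set (Q × Q × Q → Q) := {fun z => z.1, fun z => z.2.1, fun z => z.2.2}

/-- A finite set with a polynomial quasigroup operation has a polynomial Maltsev operation. -/
theorem exists_maltsev_of_quasigroup [Finite Q] {N : Set Q} {f : Q → Q → Q}
    (hf : Pol S {Prod.fst, Prod.snd} fun z : Q × Q => f z.1 z.2)
    (hN : ∀ x ∈ N, ∀ y ∈ N, f x y ∈ N) (hr : ∀ x ∈ N, Set.InjOn (f x) N)
    (hc : ∀ y ∈ N, Set.InjOn (fun x => f x y) N) :
    ∃ m : Q → Q → Q → Q, Pol S (proj3 Q) (fun z : Q × Q × Q => m z.1 z.2.1 z.2.2) ∧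
      (∀ x ∈ N, ∀ y ∈ N, ∀ z ∈ N, m x y z ∈ N) ∧
      ∀ x ∈ N, ∀ y ∈ N, m x y y = x ∧ m y y x = x := by
  obtain ⟨k, hk⟩ := exists_uniform_idempotent_iterate Q
  have hmaps : ∀ {g : Q → Q}, (∀ x ∈ N, g x ∈ N) → ∀ r, ∀ x ∈ N, g^[r] x ∈ N := fun hg r =>
    Set.MapsTo.iterate hg r
  have hid : ∀ g : Q → Q, (∀ x ∈ N, g x ∈ N) → Set.InjOn g N → ∀ x ∈ N, g^[k + 1] x = x := by
    intro g hg hinj x hx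
    exact hinj.iterate hg (k + 1) (hmaps hg _ x hx) hx (hk g x)
  let ld : Q → Q → Q := fun x z => (f x)^[k] z
  let rd : Q → Q → Q := fun z y => (fun x => f x y)^[k] z
  have ld1 : ∀ x ∈ N, ∀ z ∈ N, f x (ld x z) = z := fun x hx z hz => by
    have := hid (f x) (hN x hx) (hr x hx) z hz
    rwa [Function.iterate_succ_apply'] at this
  have rd1 : ∀ y ∈ N, ∀ z ∈ N, f (rd z y) y = z := fun y hy z hz => by
    have := hid (fun x => f x y) (fun x hx => hN x hx y hy) (hc y hy) z hz
    rwa [Function.iterate_succ_apply'] at this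
  have ldN : ∀ x ∈ N, ∀ z ∈ N, ld x z ∈ N := fun x hx => hmaps (hN x hx) k
  have rdN : ∀ y ∈ N, ∀ z ∈ N, rd z y ∈ N := fun y hy =>
    hmaps (g := fun x => f x y) (fun x hx => hN x hx y hy) k
  have hf' : Pol S {Prod.fst, Prod.snd} fun z : Q × Q => f z.2 z.1 := by
    refine hf.comp (g := Prod.swap) ?_
    rintro v (rfl | rfl)
    · exact .gen _ (Or.inr rfl)
    · exact .gen _ (Or.inl rfl)
  refine ⟨fun x y z => f (rd x (ld y y)) (ld y z), ?_, ?_, ?_⟩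
  · have p1 : Pol S (proj3 Q) fun z => z.1 := .gen _ (by simp [proj3])
    have p2 : Pol S (proj3 Q) fun z => z.2.1 := .gen _ (by simp [proj3])
    have p3 : Pol S (proj3 Q) fun z => z.2.2 := .gen _ (by simp [proj3])
    refine hf.comp (g := fun z : Q × Q × Q => (rd z.1 (ld z.2.1 z.2.1), ld z.2.1 z.2.2)) ?_
    rintro v (rfl | rfl)
    · exact Pol.iterate (f := fun y x => f x y) hf' (Pol.iterate hf p2 p2 k) p1 k
    · exact Pol.iterate hf p2 p3 k
  · exact fun x hx y hy z hz => hN _ (rdN _ (ldN y hy y hy) x hx) _ (ldN y hy z hz)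
  · intro x hx y hy
    have hw := ldN y hy y hy
    refine ⟨rd1 _ hw x hx, ?_⟩
    have : rd y (ld y y) = y := hc _ hw (rdN _ hw y hy) hy (by
      simp only [rd1 _ hw y hy, ld1 y hy y hy])
    simp only [this]
    exact ld1 y hy x hx

end Zhuk

namespace Zhuk

variable {S : Signature} {Q X Y : Type} [SAlg S Q]
variable {μ τ : Set (Q × Q)} {T : Set (Q × Q × Q × Q)} {e : Q → Q} {a b : Q}

/-- `μ` lies in the equivalence relation generated by `τ`. -/
theorem CentralCover.eqvGen (h : CentralCover S μ τ T) {x y : Q} (hxy : (x, y) ∈ μ) :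
    Relation.EqvGen (fun x y => (x, y) ∈ τ) x y := by
  let E : Set (Q × Q) := {p | Relation.EqvGen (fun x y => (x, y) ∈ τ) p.1 p.2}
  have hE : IsCongruence S E := by
    refine isCongruence_of_unary (Relation.EqvGen.is_equivalence _) fun p hp x y hxy => ?_
    change Relation.EqvGen (fun x y => (x, y) ∈ τ) x y at hxy
    change Relation.EqvGen (fun x y => (x, y) ∈ τ) (p x) (p y)
    induction hxy with
    | rel x y hxy => exact .rel _ _ (h.upol_mem hp hxy)
    | refl x => exact .refl _
    | symm x y _ ih => exact .symm _ _ ih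
    | trans x y z _ _ ih₁ ih₂ => exact .trans _ _ _ ih₁ ih₂
  obtain ⟨c, d, hne, hcd⟩ := h.nontrivial
  exact h.monolith E hE ⟨c, d, hne, .rel _ _ hcd⟩ hxy

namespace MinIdem

/-- Distinct elements of a `μ`-block are separated by a unary polynomial mapping the block into the
trace. -/
theorem exists_separating (m : MinIdem S τ e a b) (h : CentralCover S μ τ T) {x y : Q}
    (hxy : (x, y) ∈ μ) (hne : x ≠ y) :
    ∃ p, UPol S p ∧ p x ≠ p y ∧ ∀ z, (x, z) ∈ μ → p z ∈ traceSet μ e a := by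
  let θ : Set (Q × Q) := {q | ∀ p, UPol S p →
    (e (p q.1) ∈ traceSet μ e a ∨ e (p q.2) ∈ traceSet μ e a) → e (p q.1) = e (p q.2)}
  have hθ : IsCongruence S θ := by
    refine isCongruence_of_unary ⟨fun _ _ _ _ => rfl, ?_, ?_⟩ ?_
    · exact fun hxy p hp hN => (hxy p hp hN.symm).symm
    · rintro x y z hxy hyz p hp (hN | hN)
      · have h1 := hxy p hp (.inl hN)
        exact h1.trans (hyz p hp (.inl (h1 ▸ hN)))
      · have h1 := hyz p hp (.inr hN)
        exact (hxy p hp (.inr (h1 ▸ hN))).trans h1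
    · intro q hq x y hxy p hp
      exact hxy _ (hp.unary hq)
  have hnot : (x, y) ∉ θ := by
    intro hmem
    have : e a = e b := h.monolith θ hθ ⟨x, y, hne, hmem⟩ (h.sub m.mem) id .id
      (.inl (m.apply_mem h (h.con.2.refl a)))
    rw [m.left, m.right] at this
    exact m.ne this
  simp only [θ, Set.mem_ofPred_eq, not_forall] at hnot
  obtain ⟨p, hp, hN, hpne⟩ := hnot
  refine ⟨fun z => e (p z), m.pol.unary hp, hpne, fun z hz => ⟨m.idem _, ?_⟩⟩
  have hup : UPol S fun z => e (p z) := m.pol.unary hp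
  rcases hN with hN | hN
  · exact h.con.2.trans hN.2 (h.upol_mem_con hup hz)
  · exact h.con.2.trans hN.2 (h.upol_mem_con hup (h.con.2.trans (h.con.2.symm hxy) hz))

variable {f : Q → Q → Q → Q}

theorem trace_mem (m : MinIdem S τ e a b) (h : CentralCover S μ τ T)
    (hf : Pol S (proj3 Q) fun z => f z.1 z.2.1 z.2.2)
    (hm : ∀ x ∈ traceSet μ e a, ∀ y ∈ traceSet μ e a, f x y y = x ∧ f y y x = x) {x y : Q}
    (hx : x ∈ traceSet μ e a) (hy : y ∈ traceSet μ e a) : (x, y) ∈ τ := by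
  have hpm : ∀ {x x' y y' z z'}, (x, x') ∈ τ → (y, y') ∈ τ → (z, z') ∈ τ →
      (f x y z, f x' y' z') ∈ τ := by
    intro x x' y y' z z' hx hy hz
    refine h.pol_mem hf (x := (x, y, z)) (y := (x', y', z')) ?_
    rintro v (rfl | rfl | rfl) <;> assumption
  have key : ∀ {x y}, Relation.EqvGen (fun x y => (x, y) ∈ τ) x y →
      ((a, x) ∈ μ ↔ (a, y) ∈ μ) ∧ ((a, x) ∈ μ → (e x, e y) ∈ τ) := by
    intro x y hxy
    induction hxy with
    | rel x y hxy =>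
      exact ⟨⟨fun hx => h.con.2.trans hx (h.sub hxy),
        fun hy => h.con.2.trans hy (h.con.2.symm (h.sub hxy))⟩, fun _ => h.upol_mem m.pol hxy⟩
    | refl x => exact ⟨Iff.rfl, fun _ => h.refl _⟩
    | symm x y _ ih =>
      refine ⟨ih.1.symm, fun hy => ?_⟩
      have hx := ih.1.2 hy
      have hex := m.apply_mem h hx
      have hey := m.apply_mem h hy
      have := hpm (h.refl (e x)) (ih.2 hx) (h.refl (e y))
      rwa [(hm _ hey _ hex).2, (hm _ hex _ hey).1] at this
    | trans x y z _ _ ih₁ ih₂ =>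
      refine ⟨ih₁.1.trans ih₂.1, fun hx => ?_⟩
      have hy := ih₁.1.1 hx
      have hex := m.apply_mem h hx
      have hey := m.apply_mem h hy
      have hez := m.apply_mem h (ih₂.1.1 hy)
      have := hpm (ih₁.2 hx) (h.refl (e y)) (ih₂.2 hy)
      rwa [(hm _ hex _ hey).1, (hm _ hez _ hey).2] at this
  have := (key (h.eqvGen (h.con.2.trans (h.con.2.symm hx.2) hy.2))).2 hx.2
  rwa [hx.1, hy.1] at this

/-- The trace is an abelian group in which related quadruples have equal differences. -/
theorem exists_group [Finite Q] (m : MinIdem S τ e a b) (h : CentralCover S μ τ T)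
    (hf : Pol S (proj3 Q) fun z => f z.1 z.2.1 z.2.2)
    (hfN : ∀ x ∈ traceSet μ e a, ∀ y ∈ traceSet μ e a, ∀ z ∈ traceSet μ e a,
      f x y z ∈ traceSet μ e a)
    (hm : ∀ x ∈ traceSet μ e a, ∀ y ∈ traceSet μ e a, f x y y = x ∧ f y y x = x) :
    ∃ (G : Type) (_ : AddCommGroup G) (_ : Finite G) (φ : Q → G),
      Set.InjOn φ (traceSet μ e a) ∧
      ∀ x ∈ traceSet μ e a, ∀ y ∈ traceSet μ e a, ∀ z ∈ traceSet μ e a,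
        ∀ w ∈ traceSet μ e a, (x, y, z, w) ∈ T → φ x - φ y = φ z - φ w := by
  classical
  set N := traceSet μ e a with hN
  have ha : a ∈ N := m.left_mem h
  have m1 : ∀ {x y}, x ∈ N → y ∈ N → f x y y = x := fun hx hy => (hm _ hx _ hy).1
  have m2 : ∀ {x y}, x ∈ N → y ∈ N → f y y x = x := fun hx hy => (hm _ hx _ hy).2
  have row : ∀ {x y}, x ∈ N → y ∈ N → (x, x, y, y) ∈ T := fun hx hy =>
    h.row _ _ (h.con.2.trans (h.con.2.symm hx.2) hy.2)
  have col : ∀ {x y}, x ∈ N → y ∈ N → (x, y, x, y) ∈ T := fun hx hy =>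
    h.col _ _ (m.trace_mem h hf hm hx hy)
  have hT : ∀ {x y z w x' y' z' w' x'' y'' z'' w''}, (x, y, z, w) ∈ T → (x', y', z', w') ∈ T →
      (x'', y'', z'', w'') ∈ T →
      (f x x' x'', f y y' y'', f z z' z'', f w w' w'') ∈ T := by
    intro x y z w x' y' z' w' x'' y'' z'' w'' h1 h2 h3
    refine h.pol_quad hf (x := (x, x', x'')) (y := (y, y', y'')) (z := (z, z', z''))
      (w := (w, w', w'')) ?_
    rintro v (rfl | rfl | rfl) <;> assumption
  have O := row ha ha
  have cancel : ∀ {x y}, x ∈ N → y ∈ N → f x y a = a → x = y := by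
    intro x y hx hy hxy
    have := hT (col hx hy) (row hy hy) (row ha hy)
    rw [hxy, m2 ha hy, m1 hx hy, m1 hy hy] at this
    exact h.eq_of_mem _ _ _ this
  have comm : ∀ {x y}, x ∈ N → y ∈ N → f x a y = f y a x := by
    intro x y hx hy
    have X := row ha hx
    have Y := col hy ha
    have := hT (hT X O Y) (hT Y O X) O
    rw [m2 hy ha, m1 hy ha, m2 ha ha, m1 hx ha, m2 hx ha, m2 ha hy, m2 ha ha, m2 ha hx] at this
    exact cancel (hfN _ hx _ ha _ hy) (hfN _ hy _ ha _ hx) (h.eq_of_mem _ _ _ this)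
  have assoc : ∀ {x y z}, x ∈ N → y ∈ N → z ∈ N → f (f x a y) a z = f x a (f y a z) := by
    intro x y z hx hy hz
    have X := row ha hx
    have Y := col hy ha
    have Z := row ha hz
    have := hT (hT (hT X O Y) O Z) (hT X O (hT Y O Z)) O
    rw [m2 hy ha, m1 hy ha, m2 hy ha, m2 ha hy, m2 ha ha, m2 ha ha, m2 ha ha, m1 hx ha,
      m2 hz ha, m2 ha (hfN _ hx _ ha _ hz)] at this
    exact cancel (hfN _ (hfN _ hx _ ha _ hy) _ ha _ hz)
      (hfN _ hx _ ha _ (hfN _ hy _ ha _ hz)) (h.eq_of_mem _ _ _ this)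
  have neg : ∀ {x}, x ∈ N → f (f a x a) a x = a := by
    intro x hx
    have U := row hx ha
    have X := col hx ha
    have := hT (hT O X U) U X
    rw [m1 ha hx, m1 ha hx, m2 hx ha, m2 ha hx, m2 ha ha, m2 ha ha] at this
    exact h.eq_of_mem _ _ _ this
  let _ : Add N := ⟨fun x y => ⟨f x a y, hfN _ x.2 _ ha _ y.2⟩⟩
  let _ : Neg N := ⟨fun x => ⟨f a x a, hfN _ ha _ x.2 _ ha⟩⟩
  let _ : Zero N := ⟨⟨a, ha⟩⟩
  let _ : AddGroup N := AddGroup.ofLeftAxioms (fun x y z => Subtype.ext (assoc x.2 y.2 z.2))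
    (fun x => Subtype.ext (m2 x.2 ha)) (fun x => Subtype.ext (neg x.2))
  let _ : AddCommGroup N := { add_comm := fun x y => Subtype.ext (comm x.2 y.2) }
  refine ⟨N, inferInstance, inferInstance, fun x => if hx : x ∈ N then ⟨x, hx⟩ else ⟨a, ha⟩,
    fun x hx y hy hxy => ?_, fun x hx y hy z hz w hw hxyzw => ?_⟩
  · simpa [hx, hy] using hxy
  · simp only [hx, hy, hz, hw, dif_pos]
    rw [sub_eq_sub_iff_add_eq_add]
    have := hT hxyzw O (col hy hx)
    rw [comm hx hy] at this
    refine Subtype.ext ?_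
    change f x a w = f z a y
    rw [comm hx hw]
    exact (h.eq_of_mem _ _ _ this).symm

end MinIdem

end Zhuk

namespace Zhuk

variable {S : Signature} {Q X Y : Type} [SAlg S Q]
variable {μ τ : Set (Q × Q)} {T : Set (Q × Q × Q × Q)}

theorem end_sum_apply {ι W : Type*} [AddCommGroup W] (s : Finset ι) (l : ι → AddMonoid.End W)
    (w : W) : (∑ i ∈ s, l i) w = ∑ i ∈ s, l i w :=
  AddMonoidHom.finsetSum_apply l s w

namespace CentralCover

/-- A function on a set `N` with values in an abelian group for which `T`-related quadruples have
equal differences. -/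
def Difference {G : Type} [AddCommGroup G] (T : Set (Q × Q × Q × Q)) (N : Set Q) (φ : Q → G) :
    Prop :=
  ∀ x ∈ N, ∀ y ∈ N, ∀ z ∈ N, ∀ w ∈ N, (x, y, z, w) ∈ T → φ x - φ y = φ z - φ w

variable {G : Type} [AddCommGroup G] {N : Set Q} {φ : Q → G} {o : Q}

/-- The effect on `φ` of changing one argument does not depend on the other arguments. -/
theorem sub_update (h : CentralCover S μ τ T) (hφ : Difference T N φ) {n : ℕ}
    {F : (Fin n → Q) → Q} (hF : Pol S (Set.range fun (i : Fin n) (x : Fin n → Q) => x i) F)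
    (hFN : ∀ x : Fin n → Q, (∀ i, (o, x i) ∈ μ) → F x ∈ N) {y z : Fin n → Q}
    (hy : ∀ i, (o, y i) ∈ μ) (hz : ∀ i, (o, z i) ∈ μ) (k : Fin n) {c d : Q}
    (hc : (o, c) ∈ μ) (hd : (o, d) ∈ μ) :
    φ (F (Function.update y k c)) - φ (F (Function.update y k d)) =
      φ (F (Function.update z k c)) - φ (F (Function.update z k d)) := by
  have hup : ∀ {x : Fin n → Q}, (∀ i, (o, x i) ∈ μ) → ∀ {c}, (o, c) ∈ μ →
      ∀ i, (o, Function.update x k c i) ∈ μ := by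
    intro x hx c hc i
    by_cases hi : i = k
    · subst hi; simpa using hc
    · simpa [hi] using hx i
  have key : ∀ {c d}, Relation.EqvGen (fun x y => (x, y) ∈ τ) c d →
      ((o, c) ∈ μ ↔ (o, d) ∈ μ) ∧ ((o, c) ∈ μ →
        φ (F (Function.update y k c)) - φ (F (Function.update y k d)) =
          φ (F (Function.update z k c)) - φ (F (Function.update z k d))) := by
    intro c d hcd
    induction hcd with
    | rel c d hcd =>
      have hμ := h.sub hcd
      refine ⟨⟨fun hc => h.con.2.trans hc hμ,
        fun hd => h.con.2.trans hd (h.con.2.symm hμ)⟩, fun hc => ?_⟩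
      have hd := h.con.2.trans hc hμ
      refine hφ _ (hFN _ (hup hy hc)) _ (hFN _ (hup hy hd)) _ (hFN _ (hup hz hc)) _
        (hFN _ (hup hz hd)) (h.pol_quad hF ?_)
      rintro _ ⟨i, rfl⟩
      by_cases hi : i = k
      · subst hi; simpa using h.col c d hcd
      · simpa [hi] using h.row _ _ (h.con.2.trans (h.con.2.symm (hy i)) (hz i))
    | refl c => exact ⟨Iff.rfl, fun _ => by simp⟩
    | symm c d _ ih =>
      refine ⟨ih.1.symm, fun hd => ?_⟩
      rw [← neg_sub, ih.2 (ih.1.2 hd), neg_sub]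
    | trans c d e _ _ ih₁ ih₂ =>
      refine ⟨ih₁.1.trans ih₂.1, fun hc => ?_⟩
      rw [← sub_add_sub_cancel _ (φ (F (Function.update y k d))), ih₁.2 hc, ih₂.2 (ih₁.1.1 hc),
        sub_add_sub_cancel]
  exact (key (h.eqvGen (h.con.2.trans (h.con.2.symm hc) hd))).2 hc

/-- On a `μ`-block, `φ ∘ F` is the sum of functions of one variable. -/
theorem sub_eq_sum (h : CentralCover S μ τ T) (hφ : Difference T N φ) {n : ℕ}
    {F : (Fin n → Q) → Q} (hF : Pol S (Set.range fun (i : Fin n) (x : Fin n → Q) => x i) F)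
    (hFN : ∀ x : Fin n → Q, (∀ i, (o, x i) ∈ μ) → F x ∈ N) {x : Fin n → Q}
    (hx : ∀ i, (o, x i) ∈ μ) :
    φ (F x) - φ (F fun _ => o) =
      ∑ i, (φ (F (Function.update (fun _ => o) i (x i))) - φ (F fun _ => o)) := by
  have ho : (o, o) ∈ μ := h.con.2.refl o
  have key : ∀ s : Finset (Fin n), φ (F fun i => if i ∈ s then x i else o) - φ (F fun _ => o) =
      ∑ i ∈ s, (φ (F (Function.update (fun _ => o) i (x i))) - φ (F fun _ => o)) := by
    intro s
    induction s using Finset.induction_on with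
    | empty => simp
    | insert k s hk ih =>
      rw [Finset.sum_insert hk, ← ih]
      set y : Fin n → Q := fun i => if i ∈ s then x i else o with hy
      have hyμ : ∀ i, (o, y i) ∈ μ := fun i => by
        simp only [hy]; split_ifs
        · exact hx i
        · exact ho
      have h1 : (fun i => if i ∈ insert k s then x i else o) = Function.update y k (x k) := by
        funext i
        by_cases hi : i = k
        · subst hi; simp
        · simp [hi, hy]
      have h2 : Function.update y k o = y := by
        rw [Function.update_eq_self_iff]; simp [hy, hk]
      have h3 : Function.update (fun _ : Fin n => o) k o = fun _ => o := by simp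
      have := h.sub_update hφ hF hFN hyμ (fun _ => ho) k (hx k) ho
      rw [h2, h3] at this
      rw [h1, ← this, sub_add_sub_cancel]
  simpa using key Finset.univ

/-- A representation of a `μ`-block in an abelian group on which `t` acts linearly. -/
theorem exists_linear [Finite Q] (h : CentralCover S μ τ T) {n : ℕ}
    {t : STerm S n} {u v : Fin n → Fin n → Fin 2} (hn : 1 < n) (huv : ∀ i, u i i ≠ v i i)
    (ht : TaylorOn S Q t u v) (o : Q) :
    ∃ (W : Type) (_ : AddCommGroup W) (_ : Finite W) (ψ : Q → W) (l : Fin n → AddMonoid.End W),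
      Set.InjOn ψ {x | (o, x) ∈ μ} ∧ ψ o = 0 ∧
      ∀ x : Fin n → Q, (∀ i, (o, x i) ∈ μ) → ψ (t.eval x) = ∑ i, l i (ψ (x i)) := by
  obtain ⟨e, a, b, m⟩ := h.exists_minIdem
  obtain ⟨q, hq, hqN, hqr, hqc⟩ := m.exists_quasigroup h hn huv ht
  obtain ⟨f, hf, hfN, hm⟩ := exists_maltsev_of_quasigroup hq hqN hqr hqc
  obtain ⟨G, _, _, φ, hφi, hφ⟩ := m.exists_group h hf hfN hm
  set N := traceSet μ e a with hN
  let P := {p : Q → Q // UPol S p ∧ ∀ z, (o, z) ∈ μ → p z ∈ N}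
  let F : Fin n → Q → Q := fun i x => t.eval (Function.update (fun _ => o) i x)
  have ho : (o, o) ∈ μ := h.con.2.refl o
  have htμ : ∀ x : Fin n → Q, (∀ i, (o, x i) ∈ μ) → (o, t.eval x) ∈ μ := by
    intro x hx
    have := h.pol_mem_con (Pol.term t (g := fun i (x : Fin n → Q) => x i)
      (V := Set.range fun (i : Fin n) (x : Fin n → Q) => x i) fun i => .gen _ ⟨i, rfl⟩)
      (x := fun _ => o) (y := x) (by rintro _ ⟨i, rfl⟩; exact hx i)
    rwa [ht.1] at this
  have hFo : ∀ i, F i o = o := fun i => by simp [F, ht.1]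
  have hFμ : ∀ i x, (o, x) ∈ μ → (o, F i x) ∈ μ := by
    intro i x hx
    refine htμ _ fun j => ?_
    by_cases hj : j = i
    · subst hj; simpa using hx
    · simpa [hj] using ho
  have hFp : ∀ i, UPol S (F i) := by
    intro i
    refine Pol.term t (g := fun j x => Function.update (fun _ => o) i x j) fun j => ?_
    by_cases hj : j = i
    · subst hj; simp only [Function.update_self]; exact UPol.id
    · simpa [hj] using Pol.const (S := S) (V := {id}) o
  refine ⟨P → G, inferInstance, inferInstance, fun x p => φ (p.1 x) - φ (p.1 o), fun i =>
    { toFun := fun g p => g ⟨fun x => p.1 (F i x), p.2.1.unary (hFp i),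
        fun z hz => p.2.2 _ (hFμ i z hz)⟩
      map_zero' := rfl
      map_add' := fun _ _ => rfl }, ?_, ?_, ?_⟩
  · intro x hx y hy hxy
    by_contra hne
    have hx : (o, x) ∈ μ := hx
    have hxyμ := h.con.2.trans (h.con.2.symm hx) hy
    obtain ⟨p, hp, hpne, hpN⟩ := m.exists_separating h hxyμ hne
    have := congrFun hxy ⟨p, hp, fun z hz => hpN z (h.con.2.trans (h.con.2.symm hx) hz)⟩
    exact hpne (hφi (hpN x (h.con.2.refl x)) (hpN y hxyμ) (sub_left_inj.1 this))
  · funext p; simp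
  · intro x hx
    funext p
    have := h.sub_eq_sum hφ (F := fun x => p.1 (t.eval x)) (p.2.1.unary
      (Pol.term t (g := fun i (x : Fin n → Q) => x i) fun i => .gen _ ⟨i, rfl⟩))
      (fun x hx => p.2.2 _ (htμ x hx)) hx
    simp only [ht.1] at this
    rw [Finset.sum_apply]
    refine Eq.trans this (Finset.sum_congr rfl fun i _ => ?_)
    change φ (p.1 (F i (x i))) - φ (p.1 o) = φ (p.1 (F i (x i))) - φ (p.1 (F i o))
    rw [hFo]

/-- The restriction of the representation to the subgroup generated by the block. -/
theorem exists_linear_span [Finite Q] (h : CentralCover S μ τ T) {n : ℕ}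
    {t : STerm S n} {u v : Fin n → Fin n → Fin 2} (hn : 1 < n) (huv : ∀ i, u i i ≠ v i i)
    (ht : TaylorOn S Q t u v) (o : Q) :
    ∃ (W : Type) (_ : AddCommGroup W) (_ : Finite W) (ψ : Q → W) (l : Fin n → AddMonoid.End W),
      Set.InjOn ψ {x | (o, x) ∈ μ} ∧ ψ o = 0 ∧
      (∀ x : Fin n → Q, (∀ i, (o, x i) ∈ μ) → ψ (t.eval x) = ∑ i, l i (ψ (x i))) ∧
      ∀ f g : AddMonoid.End W, (∀ x, (o, x) ∈ μ → f (ψ x) = g (ψ x)) → f = g := by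
  classical
  obtain ⟨W, _, _, ψ, l, hinj, hzero, hsum⟩ := h.exists_linear hn huv ht o
  let V := AddSubgroup.closure (ψ '' {x | (o, x) ∈ μ})
  have hψ : ∀ x, (o, x) ∈ μ → ψ x ∈ V := fun x hx => AddSubgroup.subset_closure ⟨x, hx, rfl⟩
  have ho : (o, o) ∈ μ := h.con.2.refl o
  have htμ : ∀ x : Fin n → Q, (∀ i, (o, x i) ∈ μ) → (o, t.eval x) ∈ μ := by
    intro x hx
    have := h.pol_mem_con (Pol.term t (g := fun i (x : Fin n → Q) => x i)
      (V := Set.range fun (i : Fin n) (x : Fin n → Q) => x i) fun i => .gen _ ⟨i, rfl⟩)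
      (x := fun _ => o) (y := x) (by rintro _ ⟨i, rfl⟩; exact hx i)
    rwa [ht.1] at this
  have hup : ∀ x, (o, x) ∈ μ → ∀ i j, (o, Function.update (fun _ : Fin n => o) i x j) ∈ μ := by
    intro x hx i j
    by_cases hj : j = i
    · subst hj; simpa using hx
    · simpa [hj] using ho
  have hl : ∀ i, ∀ w ∈ V, l i w ∈ V := by
    intro i w hw
    induction hw using AddSubgroup.closure_induction with
    | mem w hw =>
      obtain ⟨x, hx, rfl⟩ := hw
      have := hsum _ (hup x hx i)
      rw [Finset.sum_eq_single i (fun j _ hj => by simp [hj, hzero]) (by simp)] at this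
      rw [Function.update_self] at this
      rw [← this]
      exact hψ _ (htμ _ (hup x hx i))
    | zero => simp
    | add x y _ _ hx hy => rw [map_add]; exact V.add_mem hx hy
    | neg x _ hx => rw [map_neg]; exact V.neg_mem hx
  let ψ' : Q → V := fun x => if hx : (o, x) ∈ μ then ⟨ψ x, hψ x hx⟩ else 0
  have hψ' : ∀ x, (o, x) ∈ μ → (ψ' x : W) = ψ x := fun x hx => by simp [ψ', hx]
  refine ⟨V, inferInstance, inferInstance, ψ', fun i =>
    { toFun := fun w => ⟨l i w, hl i w w.2⟩
      map_zero' := by simp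
      map_add' := fun x y => by simp }, ?_, ?_, ?_, ?_⟩
  · intro x hx y hy hxy
    refine hinj hx hy ?_
    rw [← hψ' x hx, ← hψ' y hy, hxy]
  · exact Subtype.ext (by rw [hψ' o ho, hzero]; rfl)
  · intro x hx
    refine Subtype.ext ?_
    rw [hψ' _ (htμ x hx), hsum x hx, AddSubgroup.val_finsetSum]
    exact Finset.sum_congr rfl fun i _ => by rw [← hψ' _ (hx i)]; rfl
  · intro f g hfg
    refine AddMonoidHom.ext ?_
    rintro ⟨w, hw⟩
    induction hw using AddSubgroup.closure_induction with
    | mem w hw =>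
      obtain ⟨x, hx, rfl⟩ := hw
      have h1 : (⟨ψ x, hψ x hx⟩ : V) = ψ' x := Subtype.ext (hψ' x hx).symm
      simp only [h1]
      exact hfg x hx
    | zero => exact (map_zero f).trans (map_zero g).symm
    | add x y hx hy ihx ihy =>
      change f (⟨x, hx⟩ + ⟨y, hy⟩) = g (⟨x, hx⟩ + ⟨y, hy⟩)
      rw [map_add, map_add]; exact congrArg₂ _ ihx ihy
    | neg x hx ih =>
      change f (-⟨x, hx⟩) = g (-⟨x, hx⟩)
      rw [map_neg, map_neg]; exact congrArg _ ih

/-- Each `μ`-block carries a Maltsev operation preserving `τ`. -/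
theorem exists_maltsev [Finite Q] (h : CentralCover S μ τ T) {n : ℕ}
    {t : STerm S n} {u v : Fin n → Fin n → Fin 2} (hn : 1 < n) (huv : ∀ i, u i i ≠ v i i)
    (ht : TaylorOn S Q t u v) (o : Q) :
    ∃ d : Q → Q → Q → Q, (∀ x x' y y' z z', (x, x') ∈ τ → (y, y') ∈ τ → (z, z') ∈ τ →
        (d x y z, d x' y' z') ∈ τ) ∧
      ∀ x y, (o, x) ∈ μ → (o, y) ∈ μ → d x y y = x ∧ d y y x = x := by
  classical
  obtain ⟨W, _, _, ψ, l, hinj, hzero, hsum, hext⟩ := h.exists_linear_span hn huv ht o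
  have ho : (o, o) ∈ μ := h.con.2.refl o
  have _ : Finite (AddMonoid.End W) := Finite.of_injective (fun f : AddMonoid.End W => (f : W → W))
    DFunLike.coe_injective
  have hone : ∑ i, l i = 1 := hext _ _ fun x hx => by
    have := hsum (fun _ => x) fun _ => hx
    rw [ht.1] at this
    rw [end_sum_apply, ← this]; rfl
  have hset : ∀ (w : Fin n → Fin 2) (x : Q), (o, x) ∈ μ →
      ψ (t.eval fun j => if w j = 0 then o else x) =
        (∑ j ∈ Finset.univ.filter fun j => w j ≠ 0, l j : AddMonoid.End W) (ψ x) := by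
    intro w x hx
    rw [hsum _ fun j => by split_ifs <;> assumption, end_sum_apply,
      Finset.sum_filter]
    refine Finset.sum_congr rfl fun j _ => ?_
    by_cases hj : w j = 0 <;> simp [hj, hzero]
  have htay : ∀ i, ∑ j ∈ Finset.univ.filter (fun j => u i j ≠ 0), l j =
      ∑ j ∈ Finset.univ.filter (fun j => v i j ≠ 0), l j := fun i =>
    hext _ _ fun x hx => by rw [← hset _ x hx, ← hset _ x hx, ht.2 i]
  have hcl : LinClone l 1 (-1) 1 := LinClone.malcev_of_taylor hone fun i => by
    have := huv i
    by_cases hi : u i i = 0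
    · exact ⟨_, _, by simp only [Finset.mem_filter, Finset.mem_univ, true_and]; omega,
        by simpa using hi, (htay i).symm⟩
    · exact ⟨_, _, by simpa using hi,
        by simp only [Finset.mem_filter, Finset.mem_univ, true_and]; omega, htay i⟩
  have key : ∀ {r s w : AddMonoid.End W}, LinClone l r s w → ∃ d : Q → Q → Q → Q,
      (∀ x x' y y' z z', (x, x') ∈ τ → (y, y') ∈ τ → (z, z') ∈ τ →
        (d x y z, d x' y' z') ∈ τ) ∧
      ∀ x y z, (o, x) ∈ μ → (o, y) ∈ μ → (o, z) ∈ μ →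
        (o, d x y z) ∈ μ ∧ ψ (d x y z) = r (ψ x) + s (ψ y) + w (ψ z) := by
    intro r s w hc
    induction hc with
    | fst => exact ⟨fun x _ _ => x, fun _ _ _ _ _ _ hx _ _ => hx, fun x y z hx _ _ =>
        ⟨hx, by simp⟩⟩
    | snd => exact ⟨fun _ y _ => y, fun _ _ _ _ _ _ _ hy _ => hy, fun x y z _ hy _ =>
        ⟨hy, by simp⟩⟩
    | trd => exact ⟨fun _ _ z => z, fun _ _ _ _ _ _ _ _ hz => hz, fun x y z _ _ hz =>
        ⟨hz, by simp⟩⟩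
    | app a b c _ ih =>
      choose d hdτ hd using ih
      have hterm : Pol S (Set.range fun (i : Fin n) (x : Fin n → Q) => x i) fun x => t.eval x :=
        Pol.term t (g := fun i (x : Fin n → Q) => x i) fun i => .gen _ ⟨i, rfl⟩
      refine ⟨fun x y z => t.eval fun i => d i x y z, ?_, ?_⟩
      · intro x x' y y' z z' hx hy hz
        refine h.pol_mem hterm ?_
        rintro _ ⟨i, rfl⟩
        exact hdτ i _ _ _ _ _ _ hx hy hz
      · intro x y z hx hy hz
        have hμ := fun i => (hd i x y z hx hy hz).1
        constructor
        · have := h.pol_mem_con hterm (x := fun _ => o) (y := fun i => d i x y z) (by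
            rintro _ ⟨i, rfl⟩; exact hμ i)
          rwa [ht.1] at this
        · rw [hsum _ hμ]
          simp only [end_sum_apply, ← Finset.sum_add_distrib]
          refine Finset.sum_congr rfl fun i _ => ?_
          rw [(hd i x y z hx hy hz).2, map_add, map_add]
          rfl
  obtain ⟨d, hdτ, hd⟩ := key hcl
  refine ⟨d, hdτ, fun x y hx hy => ⟨hinj (hd x y y hx hy hy).1 hx ?_,
    hinj (hd y y x hy hy hx).1 hx ?_⟩⟩
  · rw [(hd x y y hx hy hy).2]
    change ψ x + -ψ y + ψ y = ψ x
    abel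
  · rw [(hd y y x hy hy hx).2]
    change ψ y + -ψ y + ψ x = ψ x
    abel

/-- A centralized minimal cover in a finite Taylor algebra is an equivalence relation. -/
theorem equivalence [Finite Q] (h : CentralCover S μ τ T) (hTay : IsTaylorAlg S Q) :
    Equivalence fun x y => (x, y) ∈ τ := by
  obtain ⟨n, t, u, v, hn, huv, ht⟩ := hTay
  refine ⟨h.refl, fun {x y} hxy => ?_, fun {x y z} hxy hyz => ?_⟩
  · obtain ⟨d, hdτ, hd⟩ := h.exists_maltsev hn huv ht x
    have := hdτ _ _ _ _ _ _ (h.refl x) hxy (h.refl y)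
    rwa [(hd y x (h.sub hxy) (h.con.2.refl x)).2, (hd x y (h.con.2.refl x) (h.sub hxy)).1] at this
  · obtain ⟨d, hdτ, hd⟩ := h.exists_maltsev hn huv ht x
    have hy := h.sub hxy
    have := hdτ _ _ _ _ _ _ hxy (h.refl y) hyz
    rwa [(hd x y (h.con.2.refl x) hy).1, (hd z y (h.con.2.trans hy (h.sub hyz)) hy).2] at this

end CentralCover

end Zhuk

namespace Zhuk

variable {S : Signature} {A : Type} [SAlg S A] {ρ ρplus τ γ φ θ : Set (A × A)}
  {T T' : Set (A × A × A × A)}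

section Saturated

theorem Saturated.stable (hρ : IsCongruence S ρ) (h : Saturated ρ τ) {a b a' b' : A}
    (hab : (a, b) ∈ τ) (ha : (a, a') ∈ ρ) (hb : (b, b') ∈ ρ) : (a', b') ∈ τ := by
  rw [← h]
  exact ⟨a, hρ.2.symm ha, b, hab, hb⟩

theorem saturated_of_stable (hρ : IsCongruence S ρ)
    (h : ∀ a b a' b', (a, b) ∈ τ → (a, a') ∈ ρ → (b, b') ∈ ρ → (a', b') ∈ τ) :
    Saturated ρ τ := by
  ext ⟨a, b⟩
  constructor
  · rintro ⟨a', ha, b', hab, hb⟩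
    exact h _ _ _ _ hab (hρ.2.symm ha) hb
  · exact fun hab => ⟨a, hρ.2.refl a, b, hab, hρ.2.refl b⟩

end Saturated

section Quotient

/-- The kernel setoid of a congruence. -/
def conSetoid (hρ : IsCongruence S ρ) : Setoid A := ⟨fun a b => (a, b) ∈ ρ, hρ.2⟩

/-- The quotient algebra by a congruence. -/
noncomputable abbrev conAlg (hρ : IsCongruence S ρ) : SAlg S (Quotient (conSetoid hρ)) :=
  ⟨fun o x => Quotient.mk _ (SAlg.interp o fun i => (x i).out)⟩

variable (hρ : IsCongruence S ρ)

theorem mk_eq_mk {a b : A} :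
    Quotient.mk (conSetoid hρ) a = Quotient.mk (conSetoid hρ) b ↔ (a, b) ∈ ρ :=
  Quotient.eq (r := conSetoid hρ)

theorem out_mk_mem (a : A) : (a, (Quotient.mk (conSetoid hρ) a).out) ∈ ρ := by
  rw [← mk_eq_mk hρ, Quotient.out_eq]

theorem mk_interp (o : S.ops) (x : Fin (S.arity o) → A) :
    Quotient.mk (conSetoid hρ) (SAlg.interp o x) =
      (conAlg hρ).interp o fun i => Quotient.mk (conSetoid hρ) (x i) :=
  (mk_eq_mk hρ).2 (hρ.1 o (fun i => (x i, _)) fun i => out_mk_mem hρ (x i))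

theorem mk_eval {n : ℕ} (t : STerm S n) (x : Fin n → A) :
    Quotient.mk (conSetoid hρ) (t.eval x) =
      letI := conAlg hρ
      t.eval fun i => Quotient.mk (conSetoid hρ) (x i) := by
  induction t with
  | var i => rfl
  | app o ts ih => exact (mk_interp hρ o _).trans (congrArg _ (funext ih))

theorem isTaylorAlg_quotient (h : IsTaylorAlg S A) :
    letI := conAlg hρ
    IsTaylorAlg S (Quotient (conSetoid hρ)) := by
  obtain ⟨n, t, u, v, hn, huv, ht⟩ := h
  refine ⟨n, t, u, v, hn, huv, fun a => ?_, fun i x y => ?_⟩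
  · induction a using Quotient.inductionOn with
    | h a => rw [← mk_eval, ht.1]
  · induction x using Quotient.inductionOn with
    | h x =>
      induction y using Quotient.inductionOn with
      | h y =>
        simp only [← apply_ite (Quotient.mk (conSetoid hρ))]
        rw [← mk_eval, ← mk_eval, ht.2]

/-- The relation induced on the quotient by a saturated binary relation. -/
def quotRel (R : Set (A × A)) : Set (Quotient (conSetoid hρ) × Quotient (conSetoid hρ)) :=
  {q | (q.1.out, q.2.out) ∈ R}

theorem isSubuniverse_quotRel (hsub : IsSubuniverse S τ) (hsat : Saturated ρ τ) :
    letI := conAlg hρ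
    IsSubuniverse S (quotRel hρ τ) := by
  intro o x hx
  exact hsat.stable hρ (hsub o (fun i => ((x i).1.out, (x i).2.out)) hx) (out_mk_mem hρ _)
    (out_mk_mem hρ _)

/-- The preimage in `A²` of a relation on the quotient. -/
def liftRel (R : Set (Quotient (conSetoid hρ) × Quotient (conSetoid hρ))) : Set (A × A) :=
  {p | (Quotient.mk _ p.1, Quotient.mk _ p.2) ∈ R}

theorem isSubuniverse_liftRel {R : Set (Quotient (conSetoid hρ) × Quotient (conSetoid hρ))}
    (h : letI := conAlg hρ; IsSubuniverse S R) : IsSubuniverse S (liftRel hρ R) := by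
  intro o x hx
  have := h o (fun i => (Quotient.mk _ (x i).1, Quotient.mk _ (x i).2)) hx
  change (Quotient.mk _ (SAlg.interp o fun i => (x i).1),
    Quotient.mk _ (SAlg.interp o fun i => (x i).2)) ∈ R
  rw [mk_interp, mk_interp]
  exact this

theorem saturated_liftRel (R : Set (Quotient (conSetoid hρ) × Quotient (conSetoid hρ))) :
    Saturated ρ (liftRel hρ R) := by
  refine saturated_of_stable hρ fun a b a' b' hab ha hb => ?_
  change (Quotient.mk _ a', Quotient.mk _ b') ∈ R
  rw [← (mk_eq_mk hρ).2 ha, ← (mk_eq_mk hρ).2 hb]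
  exact hab

theorem ssubset_liftRel {R : Set (Quotient (conSetoid hρ) × Quotient (conSetoid hρ))}
    (hr : ∀ c, (c, c) ∈ R) (h : ∃ c d, c ≠ d ∧ (c, d) ∈ R) : ρ ⊂ liftRel hρ R := by
  refine ⟨fun p hp => ?_, fun hsub => ?_⟩
  · change (Quotient.mk _ p.1, Quotient.mk _ p.2) ∈ R
    rw [(mk_eq_mk hρ).2 hp]
    exact hr _
  · obtain ⟨c, d, hne, hcd⟩ := h
    have : (c.out, d.out) ∈ ρ := hsub (by
      change (Quotient.mk _ c.out, Quotient.mk _ d.out) ∈ R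
      rwa [Quotient.out_eq, Quotient.out_eq])
    rw [← mk_eq_mk hρ, Quotient.out_eq, Quotient.out_eq] at this
    exact hne this

theorem subset_of_subset_liftRel {R : Set (Quotient (conSetoid hρ) × Quotient (conSetoid hρ))}
    (h : τ ⊆ liftRel hρ R) : quotRel hρ τ ⊆ R := by
  rintro ⟨c, d⟩ hcd
  have : (Quotient.mk _ c.out, Quotient.mk _ d.out) ∈ R := h hcd
  rwa [Quotient.out_eq, Quotient.out_eq] at this

/-- A bridge whose trace contains the upper cover of `ρ` yields a centralized cover in the
quotient by `ρ`. -/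
theorem centralCover_quotient (hmi : MeetIrredWith S ρ ρplus) (hτ : τ ∈ CovPlus S ρ ρplus)
    (hT : IsBridge S ρ ρ T) (hrow : ∀ a b, (a, b) ∈ ρplus → (a, a, b, b) ∈ T)
    (hcol : ∀ c d, (c, d) ∈ τ → (c, d, c, d) ∈ T) :
    letI := conAlg hmi.1
    CentralCover S (quotRel hmi.1 ρplus) (quotRel hmi.1 τ)
      {q | (q.1.out, q.2.1.out, q.2.2.1.out, q.2.2.2.out) ∈ T} := by
  obtain ⟨hρ, -, hplus, hlt, hmono⟩ := id hmi
  obtain ⟨⟨hsub, hsat, hρτ, hmin⟩, hτplus⟩ := hτ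
  obtain ⟨hTsub, hT1, hT2, -, -, hTB⟩ := hT
  let _ := conAlg hρ
  refine
    { con := ⟨?_, ⟨fun _ => hplus.2.refl _, hplus.2.symm, hplus.2.trans⟩⟩
      monolith := fun θ hθ hne => ?_
      sub := fun q hq => hτplus hq
      subuniverse := isSubuniverse_quotRel hρ hsub hsat
      refl := fun c => hρτ.1 (hρ.2.refl _)
      nontrivial := ?_
      minimal := fun τ' hτ' hr hle hne => ?_
      subuniverse_quad := fun o x hx => ?_
      row := fun a b hab => hrow _ _ hab
      col := fun c d hcd => hcol _ _ hcd
      eq_of_mem := fun x z w hx => ?_ }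
  · exact isSubuniverse_quotRel hρ hplus.1 (saturated_of_stable hρ fun a b a' b' hab ha hb =>
      hplus.2.trans (hplus.2.symm (hlt.1 ha)) (hplus.2.trans hab (hlt.1 hb)))
  · refine subset_of_subset_liftRel hρ (hmono _ ⟨isSubuniverse_liftRel hρ hθ.1,
      ⟨fun _ => hθ.2.refl _, hθ.2.symm, hθ.2.trans⟩⟩ (ssubset_liftRel hρ hθ.2.refl hne))
  · obtain ⟨⟨c, d⟩, hcd, hncd⟩ := Set.exists_of_ssubset hρτ
    exact ⟨_, _, fun he => hncd ((mk_eq_mk hρ).1 he),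
      hsat.stable hρ hcd (out_mk_mem hρ c) (out_mk_mem hρ d)⟩
  · refine hle.antisymm (subset_of_subset_liftRel hρ (hmin _ (isSubuniverse_liftRel hρ hτ')
      (saturated_liftRel hρ τ') (ssubset_liftRel hρ hr hne) ?_).ge)
    rintro ⟨a, b⟩ hab
    have hab : (Quotient.mk _ a, Quotient.mk _ b) ∈ quotRel hρ τ := hle hab
    exact hsat.stable hρ hab (hρ.2.symm (out_mk_mem hρ a)) (hρ.2.symm (out_mk_mem hρ b))
  · exact hT2 _ _ _ _ _ _ (hT1 _ _ _ _ _ _ (hTsub o (fun i => ((x i).1.out, (x i).2.1.out,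
      (x i).2.2.1.out, (x i).2.2.2.out)) hx) (out_mk_mem hρ _) (out_mk_mem hρ _))
      (out_mk_mem hρ _) (out_mk_mem hρ _)
  · have := (hTB _ _ _ _ hx).1 (hρ.2.refl _)
    rwa [← mk_eq_mk hρ, Quotient.out_eq, Quotient.out_eq] at this

end Quotient

section TermCondition

/-- Renaming of variables in a term. -/
def STerm.rename {m n : ℕ} (f : Fin n → Fin m) : STerm S n → STerm S m
  | .var i => .var (f i)
  | .app o ts => .app o fun i => (ts i).rename f

theorem STerm.eval_rename {m n : ℕ} (f : Fin n → Fin m) (t : STerm S n) (x : Fin m → A) :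
    (t.rename f).eval x = t.eval fun i => x (f i) := by
  induction t with
  | var i => rfl
  | app o ts ih => exact congrArg _ (funext ih)

theorem STerm.eval_prod {B : Type} [SAlg S B] {n : ℕ} (t : STerm S n) (x : Fin n → A × B) :
    t.eval x = (t.eval fun i => (x i).1, t.eval fun i => (x i).2) := by
  induction t with
  | var i => rfl
  | app o ts ih =>
    exact (congrArg (SAlg.interp o) (funext ih)).trans rfl

/-- The generators of the matrices of the term condition for `C(φ, θ; δ)`. -/
def IsMatrixGen (φ θ : Set (A × A)) (q : A × A × A × A) : Prop :=
  (q.1 = q.2.1 ∧ q.2.2.1 = q.2.2.2 ∧ (q.1, q.2.2.1) ∈ φ) ∨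
    (q.1 = q.2.2.1 ∧ q.2.1 = q.2.2.2 ∧ (q.1, q.2.1) ∈ θ)

/-- The term condition with several variables ranging over `φ`. -/
theorem Centralizes.eval_mem (h : Centralizes S φ θ ρ) (hθ : ∀ c, (c, c) ∈ θ) {n : ℕ}
    (s : STerm S n) {x : Fin n → A × A × A × A} (hx : ∀ i, IsMatrixGen φ θ (x i))
    (hs : (s.eval fun i => (x i).1, s.eval fun i => (x i).2.1) ∈ ρ) :
    (s.eval fun i => (x i).2.2.1, s.eval fun i => (x i).2.2.2) ∈ ρ := by
  classical
  have key : ∀ K : Finset (Fin n), (s.eval fun i => if i ∈ K then (x i).2.2.1 else (x i).1,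
      s.eval fun i => if i ∈ K then (x i).2.2.2 else (x i).2.1) ∈ ρ := by
    intro K
    induction K using Finset.induction_on with
    | empty => simpa using hs
    | insert k K hk ih =>
      rcases hx k with ⟨h1, h2, h3⟩ | ⟨h1, h2, h3⟩
      · have := h n (s.rename fun i => if i = k then 0 else i.succ) (x k).1 (x k).2.2.1
          (fun i => if i ∈ K then (x i).2.2.1 else (x i).1)
          (fun i => if i ∈ K then (x i).2.2.2 else (x i).2.1) h3 (fun i => ?_)
        · simp only [STerm.eval_rename, apply_ite (Fin.cons _ _ : Fin (n + 1) → A),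
            Fin.cons_zero, Fin.cons_succ] at this
          convert this ?_ using 3
          · funext i
            by_cases hi : i = k
            · subst hi; simp
            · simp [hi]
          · funext i
            by_cases hi : i = k
            · subst hi; simp [h2]
            · simp [hi]
          · convert ih using 3
            · funext i
              by_cases hi : i = k
              · subst hi; simp [hk]
              · simp [hi]
            · funext i
              by_cases hi : i = k
              · subst hi; simp [hk, h1]
              · simp [hi]
        · rcases hx i with ⟨h1, h2, -⟩ | ⟨h1, h2, h3⟩
          · split_ifs
            · rw [h2]; exact hθ _
            · rw [h1]; exact hθ _
          · split_ifs
            · rw [← h1, ← h2]; exact h3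
            · exact h3
      · convert ih using 3
        · funext i
          by_cases hi : i = k
          · subst hi; simp [h1]
          · simp [hi]
        · funext i
          by_cases hi : i = k
          · subst hi; simp [h2]
          · simp [hi]
  simpa using key Finset.univ

end TermCondition

section Bridges

/-- A reflexive bridge from `(A, ρ, τ)` to itself. -/
def IsReflBridge (S : Signature) {A : Type} [SAlg S A] (ρ τ : Set (A × A))
    (T : Set (A × A × A × A)) : Prop :=
  IsBridgeLR S ρ ρ τ τ T ∧ ReflBridge T

namespace IsReflBridge

theorem comp (h : IsReflBridge S ρ τ T) (h' : IsReflBridge S ρ τ T') :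
    IsReflBridge S ρ τ (bComp T T') := by
  obtain ⟨⟨⟨hs, h1, h2, h3, h4, hB⟩, hl, hr⟩, href⟩ := h
  obtain ⟨⟨⟨hs', h1', h2', h3', h4', hB'⟩, hl', hr'⟩, href'⟩ := h'
  have hL : pr12 (bComp T T') = τ := by
    refine Set.Subset.antisymm ?_ ?_
    · rintro ⟨a, b⟩ ⟨c, d, x, y, hxy, -⟩
      rw [← hl]; exact ⟨x, y, hxy⟩
    · rintro ⟨a, b⟩ hab
      rw [← hl] at hab
      obtain ⟨x, y, hxy⟩ := hab
      have : (x, y) ∈ pr12 T' := by rw [hl', ← hr]; exact ⟨a, b, hxy⟩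
      obtain ⟨c, d, hcd⟩ := this
      exact ⟨c, d, x, y, hxy, hcd⟩
  have hR : pr34 (bComp T T') = τ := by
    refine Set.Subset.antisymm ?_ ?_
    · rintro ⟨a, b⟩ ⟨c, d, x, y, -, hxy⟩
      rw [← hr']; exact ⟨x, y, hxy⟩
    · rintro ⟨a, b⟩ hab
      rw [← hr'] at hab
      obtain ⟨x, y, hxy⟩ := hab
      have : (x, y) ∈ pr34 T := by rw [hr, ← hl']; exact ⟨a, b, hxy⟩
      obtain ⟨c, d, hcd⟩ := this
      exact ⟨c, d, x, y, hcd, hxy⟩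
  refine ⟨⟨⟨?_, ?_, ?_, ?_, ?_, ?_⟩, hL, hR⟩, fun a => ⟨a, a, href a, href' a⟩⟩
  · intro o x hx
    choose b c hbc hbc' using hx
    exact ⟨_, _, hs o (fun i => ((x i).1, (x i).2.1, b i, c i)) hbc,
      hs' o (fun i => (b i, c i, (x i).2.2.1, (x i).2.2.2)) hbc'⟩
  · rintro a b c d a' b' ⟨x, y, hxy, hxy'⟩ ha hb
    exact ⟨x, y, h1 _ _ _ _ _ _ hxy ha hb, hxy'⟩
  · rintro a b c d c' d' ⟨x, y, hxy, hxy'⟩ hc hd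
    exact ⟨x, y, hxy, h2' _ _ _ _ _ _ hxy' hc hd⟩
  · rwa [hL, ← hl]
  · rwa [hR, ← hr]
  · rintro a b c d ⟨x, y, hxy, hxy'⟩
    exact (hB _ _ _ _ hxy).trans (hB' _ _ _ _ hxy')

theorem conv (h : IsReflBridge S ρ τ T) : IsReflBridge S ρ τ (bConv T) := by
  obtain ⟨⟨⟨hs, h1, h2, h3, h4, hB⟩, hl, hr⟩, href⟩ := h
  have hL : pr12 (bConv T) = pr34 T := rfl
  have hR : pr34 (bConv T) = pr12 T := rfl
  refine ⟨⟨⟨?_, ?_, ?_, h4, h3, ?_⟩, hr, hl⟩, href⟩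
  · exact fun o x hx => hs o (fun i => ((x i).2.2.1, (x i).2.2.2, (x i).1, (x i).2.1)) hx
  · exact fun a b c d a' b' hT ha hb => h2 _ _ _ _ _ _ hT ha hb
  · exact fun a b c d a' b' hT ha hb => h1 _ _ _ _ _ _ hT ha hb
  · exact fun a b c d hT => (hB _ _ _ _ hT).symm

theorem con_subset_btr (h : IsReflBridge S ρ τ T) : ρ ⊆ btr T :=
  fun p hp => h.1.1.2.2.1 _ _ _ _ _ _ (h.2 p.1) hp hp

theorem exists_of_centralizes [Finite A] (hρ : IsCongruence S ρ) (hplus : IsCongruence S ρplus)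
    (hτ : τ ∈ CovPlus S ρ ρplus) (hφ : IsCongruence S φ) (h : Centralizes S φ ρplus ρ) :
    ∃ T, IsReflBridge S ρ τ T ∧ φ ⊆ btr T := by
  obtain ⟨⟨hsub, hsat, hρτ, -⟩, hle⟩ := hτ
  obtain ⟨n, ⟨e⟩⟩ := Finite.exists_equiv_fin {q : A × A × A × A // IsMatrixGen φ ρplus q}
  let x : Fin n → A × A × A × A := fun i => (e.symm i).1
  have hx : ∀ i, IsMatrixGen φ ρplus (x i) := fun i => (e.symm i).2
  let M : Set (A × A × A × A) := Set.range fun s : STerm S n => s.eval x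
  have hgen : ∀ q, IsMatrixGen φ ρplus q → q ∈ M := fun q hq =>
    ⟨.var (e ⟨q, hq⟩), by simp [STerm.eval, x]⟩
  have hMsub : IsSubuniverse S M := by
    intro o q hq
    choose s hs using hq
    exact ⟨.app o s, congrArg _ (funext hs)⟩
  have hM : ∀ a b c d, (a, b, c, d) ∈ M → ((a, b) ∈ ρ ↔ (c, d) ∈ ρ) := by
    rintro a b c d ⟨s, hs⟩
    simp only [STerm.eval_prod, Prod.mk.injEq] at hs
    obtain ⟨rfl, rfl, rfl, rfl⟩ := hs
    refine ⟨h.eval_mem hplus.2.refl s hx, h.eval_mem hplus.2.refl s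
      (x := fun i => ((x i).2.2.1, (x i).2.2.2, (x i).1, (x i).2.1)) fun i => ?_⟩
    rcases hx i with ⟨h1, h2, h3⟩ | ⟨h1, h2, h3⟩
    · exact .inl ⟨h2, h1, hφ.2.symm h3⟩
    · refine .inr ⟨h1.symm, h2.symm, ?_⟩
      rwa [← h1, ← h2]
  let U : Set (A × A × A × A) := {p | (p.1, p.2.1) ∈ τ ∧ (p.2.2.1, p.2.2.2) ∈ τ ∧
    ∃ q ∈ M, (p.1, q.1) ∈ ρ ∧ (p.2.1, q.2.1) ∈ ρ ∧ (p.2.2.1, q.2.2.1) ∈ ρ ∧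
      (p.2.2.2, q.2.2.2) ∈ ρ}
  have hMU : ∀ a b c d, (a, b) ∈ τ → (c, d) ∈ τ → (a, b, c, d) ∈ M → (a, b, c, d) ∈ U :=
    fun a b c d hab hcd hq =>
      ⟨hab, hcd, _, hq, hρ.2.refl _, hρ.2.refl _, hρ.2.refl _, hρ.2.refl _⟩
  have hcol : ∀ c d, (c, d) ∈ τ → (c, d, c, d) ∈ U := fun c d hcd =>
    hMU _ _ _ _ hcd hcd (hgen _ (.inr ⟨rfl, rfl, hle hcd⟩))
  have hrow : ∀ a b, (a, b) ∈ φ → (a, a, b, b) ∈ U := fun a b hab =>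
    hMU _ _ _ _ (hρτ.1 (hρ.2.refl a)) (hρτ.1 (hρ.2.refl b)) (hgen _ (.inl ⟨rfl, rfl, hab⟩))
  have hL : pr12 U = τ := Set.Subset.antisymm (fun p ⟨_, _, hp⟩ => hp.1)
    fun p hp => ⟨p.1, p.2, hcol _ _ hp⟩
  have hR : pr34 U = τ := Set.Subset.antisymm (fun p ⟨_, _, hp⟩ => hp.2.1)
    fun p hp => ⟨p.1, p.2, hcol _ _ hp⟩
  refine ⟨U, ⟨⟨⟨?_, ?_, ?_, by rwa [hL], by rwa [hR], ?_⟩, hL, hR⟩,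
    fun a => hrow a a (hφ.2.refl a)⟩, fun p hp => hrow _ _ hp⟩
  · intro o p hp
    choose h12 h34 q hq h1 h2 h3 h4 using hp
    exact ⟨hsub o (fun i => ((p i).1, (p i).2.1)) h12,
      hsub o (fun i => ((p i).2.2.1, (p i).2.2.2)) h34, _, hMsub o q hq,
      hρ.1 o (fun i => ((p i).1, (q i).1)) h1, hρ.1 o (fun i => ((p i).2.1, (q i).2.1)) h2,
      hρ.1 o (fun i => ((p i).2.2.1, (q i).2.2.1)) h3,
      hρ.1 o (fun i => ((p i).2.2.2, (q i).2.2.2)) h4⟩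
  · rintro a b c d a' b' ⟨h12, h34, q, hq, h1, h2, h3, h4⟩ ha hb
    exact ⟨hsat.stable hρ h12 ha hb, h34, q, hq, hρ.2.trans (hρ.2.symm ha) h1,
      hρ.2.trans (hρ.2.symm hb) h2, h3, h4⟩
  · rintro a b c d c' d' ⟨h12, h34, q, hq, h1, h2, h3, h4⟩ hc hd
    exact ⟨h12, hsat.stable hρ h34 hc hd, q, hq, h1, h2, hρ.2.trans (hρ.2.symm hc) h3,
      hρ.2.trans (hρ.2.symm hd) h4⟩
  · rintro a b c d ⟨-, -, ⟨q1, q2, q3, q4⟩, hq, h1, h2, h3, h4⟩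
    refine Iff.trans ⟨fun h => ?_, fun h => ?_⟩ ((hM _ _ _ _ hq).trans ⟨fun h => ?_, fun h => ?_⟩)
    · exact hρ.2.trans (hρ.2.symm h1) (hρ.2.trans h h2)
    · exact hρ.2.trans h1 (hρ.2.trans h (hρ.2.symm h2))
    · exact hρ.2.trans h3 (hρ.2.trans h (hρ.2.symm h4))
    · exact hρ.2.trans (hρ.2.symm h3) (hρ.2.trans h h4)

/-- The term condition read off from a bridge. -/
theorem centralizes (h : IsReflBridge S ρ τ T)
    (hrow : ∀ a b, (a, b) ∈ γ → (a, a, b, b) ∈ T)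
    (hcol : ∀ c d, (c, d) ∈ τ → (c, d, c, d) ∈ T) : Centralizes S γ τ ρ := by
  intro n t a b c d hab hcd
  refine (h.1.1.2.2.2.2.2 _ _ _ _ ?_).1
  refine (Pol.term t (g := fun i (x : Fin (n + 1) → A) => x i)
    (V := Set.range fun (i : Fin (n + 1)) (x : Fin (n + 1) → A) => x i)
    fun i => .gen _ ⟨i, rfl⟩).quad_mem h.1.1.1 h.2 ?_
  rintro _ ⟨i, rfl⟩
  refine Fin.cases ?_ (fun i => ?_) i
  · exact hrow a b hab
  · exact hcol _ _ (hcd i)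

end IsReflBridge

theorem centralizes_self (hρ : IsCongruence S ρ) : Centralizes S ρ θ ρ := by
  intro n t a b c d hab _ ht
  have key : ∀ c : Fin n → A, (t.eval (Fin.cons a c), t.eval (Fin.cons b c)) ∈ ρ := by
    intro c
    refine (Pol.term t (g := fun i (x : Fin (n + 1) → A) => x i)
      (V := Set.range fun (i : Fin (n + 1)) (x : Fin (n + 1) → A) => x i)
      fun i => .gen _ ⟨i, rfl⟩).pair_mem hρ.1 hρ.2.refl ?_
    rintro _ ⟨i, rfl⟩
    refine Fin.cases ?_ (fun i => ?_) i
    · exact hab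
    · exact hρ.2.refl _
  exact hρ.2.trans (hρ.2.symm (key c)) (hρ.2.trans ht (key d))

theorem IsOptOf.btr_subset (h : IsOptOf S ρ τ γ) (hT : IsReflBridge S ρ τ T) : btr T ⊆ γ := by
  obtain ⟨⟨T₀, h₀, href, rfl⟩, hmax⟩ := h
  have hc := IsReflBridge.comp (⟨h₀, href⟩ : IsReflBridge S ρ τ T₀) hT
  rw [← hmax _ ⟨_, hc.1, hc.2, rfl⟩ fun p hp => ⟨p.2, p.2, hp, hT.2 _⟩]
  exact fun p hp => ⟨p.1, p.1, href _, hp⟩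

theorem IsOptOf.isCongruence (h : IsOptOf S ρ τ γ) : IsCongruence S γ := by
  obtain ⟨⟨T₀, h₀, href, rfl⟩, -⟩ := id h
  have hT₀ : IsReflBridge S ρ τ T₀ := ⟨h₀, href⟩
  refine ⟨fun o x hx => h₀.1.1 o (fun i => ((x i).1, (x i).1, (x i).2, (x i).2)) hx, href,
    fun {a b} hab => h.btr_subset hT₀.conv hab, fun {a b c} hab hbc => ?_⟩
  exact h.btr_subset (hT₀.comp hT₀) ⟨b, b, hab, hbc⟩

theorem IsOptOf.exists_bridge (h : IsOptOf S ρ τ γ) : ∃ T, IsReflBridge S ρ τ T ∧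
    (∀ a b, (a, b) ∈ γ → (a, a, b, b) ∈ T) ∧ ∀ c d, (c, d) ∈ τ → (c, d, c, d) ∈ T := by
  obtain ⟨⟨T₀, h₀, href, rfl⟩, -⟩ := h
  have hT₀ : IsReflBridge S ρ τ T₀ := ⟨h₀, href⟩
  refine ⟨_, hT₀.comp hT₀.conv, fun a b hab => ⟨b, b, hab, href b⟩, fun c d hcd => ?_⟩
  rw [← h₀.2.1] at hcd
  obtain ⟨x, y, hxy⟩ := hcd
  exact ⟨x, y, hxy, hxy⟩

theorem IsOptOf.centralizes [Finite A] (hTay : IsTaylorAlg S A) (hmi : MeetIrredWith S ρ ρplus)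
    (hτ : τ ∈ CovPlus S ρ ρplus) (h : IsOptOf S ρ τ γ) (hlt : ρ ⊂ γ) :
    Centralizes S γ ρplus ρ := by
  obtain ⟨T, hT, hrow, hcol⟩ := h.exists_bridge
  have hle : ρplus ⊆ γ := hmi.2.2.2.2 γ h.isCongruence hlt
  have hC := centralCover_quotient hmi hτ hT.1.1 (fun a b hab => hrow a b (hle hab)) hcol
  let _ := conAlg hmi.1
  have hE := hC.equivalence (isTaylorAlg_quotient hmi.1 hTay)
  obtain ⟨⟨hsub, hsat, hρτ, -⟩, hτplus⟩ := hτ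
  have hmem : ∀ {a b}, (a, b) ∈ τ ↔ (Quotient.mk _ a, Quotient.mk _ b) ∈ quotRel hmi.1 τ :=
    ⟨fun hab => hsat.stable hmi.1 hab (out_mk_mem hmi.1 _) (out_mk_mem hmi.1 _),
      fun hab => hsat.stable hmi.1 hab (hmi.1.2.symm (out_mk_mem hmi.1 _))
        (hmi.1.2.symm (out_mk_mem hmi.1 _))⟩
  have hτcon : IsCongruence S τ := ⟨hsub, fun a => hρτ.1 (hmi.1.2.refl a),
    fun hab => hmem.2 (hE.symm (hmem.1 hab)),
    fun hab hbc => hmem.2 (hE.trans (hmem.1 hab) (hmem.1 hbc))⟩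
  rw [← hτplus.antisymm (hmi.2.2.2.2 τ hτcon hρτ)]
  exact hT.centralizes hrow hcol

theorem IsOptOf.eq_centralizer [Finite A] (hTay : IsTaylorAlg S A)
    (hmi : MeetIrredWith S ρ ρplus) (hτ : τ ∈ CovPlus S ρ ρplus) (h : IsOptOf S ρ τ γ) :
    γ = centralizer S ρ ρplus := by
  refine Set.Subset.antisymm (Set.subset_sUnion_of_mem ⟨h.isCongruence, ?_⟩)
    (Set.sUnion_subset ?_)
  · obtain ⟨T, hT, -, -⟩ := h.exists_bridge
    have hle : ρ ⊆ γ := hT.con_subset_btr.trans (h.btr_subset hT)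
    rcases hle.eq_or_ssubset with rfl | hlt
    · exact centralizes_self hmi.1
    · exact h.centralizes hTay hmi hτ hlt
  · rintro φ ⟨hφ, hC⟩
    obtain ⟨T, hT, hle⟩ := IsReflBridge.exists_of_centralizes hmi.1 hmi.2.2.1 hτ hφ hC
    exact hle.trans (h.btr_subset hT)

end Bridges

end Zhuk

/-- `Opt(ρ) = (ρ : ρ⁺)`; consequently `ρ⁺/ρ` is abelian iff `Opt(ρ) > ρ`. -/
theorem stmt_9 {S : Zhuk.Signature} {A : Type} [Zhuk.SAlg S A] [Finite A]
    (hTay : Zhuk.IsTaylorAlg S A)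
    (ρ ρplus : Set (A × A)) (hmi : Zhuk.MeetIrredWith S ρ ρplus) :
    ∀ τ ∈ Zhuk.CovPlus S ρ ρplus, ∀ γ : Set (A × A), Zhuk.IsOptOf S ρ τ γ →
      γ = Zhuk.centralizer S ρ ρplus ∧
      (Zhuk.Centralizes S ρplus ρplus ρ ↔ ρ ⊂ γ) := by
  intro τ hτ γ hγ
  have heq := hγ.eq_centralizer hTay hmi hτ
  refine ⟨heq, fun hC => ?_, fun hlt => ?_⟩
  · rw [heq]
    exact hmi.2.2.2.1.trans_subset (Set.subset_sUnion_of_mem ⟨hmi.2.2.1, hC⟩)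
  · have hle := hmi.2.2.2.2 γ hγ.isCongruence hlt
    exact fun n t a b c d hab => hγ.centralizes hTay hmi hτ hlt n t a b c d (hle hab)
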